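/- If (Y,θ) is a generating system of n nondegenerate regular A-correspondences, then O(Y_1∗⋯∗Y_n) ≅ O(Y_n ⊗_A O(Y_1∗⋯∗Y_{n-1})), where Y_n ⊗_A O(Y_1∗⋯∗Y_{n-1}) carries the O(Y_1∗⋯∗Y_{n-1})-correspondence structure whose left action is determined by the isomorphisms θ_{in} via the absorption maps. -/

import Mathlib

/- ############################################################
   Common framework: C*-correspondences, interior tensor products
   (characterized relationally), representations, Cuntz–Pimsner algebras,
   product systems over ℕ^k, generating systems, and the ℰ / ℛθ
   constructions of the paper (characterized relationally).
   ############################################################ -/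

noncomputable section

open Filter Topology

universe u

/-- A C*-correspondence over a (not necessarily unital) C*-algebra `A`:
a right Hilbert `A`-module `X` together with a left action of `A` by
adjointable (bounded) operators.  The rank-one operators `θ_{x,y}` are
bundled as data together with their defining property. -/
structure Corr (A : Type u) [NonUnitalCStarAlgebra A] : Type (u + 1) where
  X : Type u
  [nacg : NormedAddCommGroup X]
  [nsp : NormedSpace ℂ X]
  [cmpl : CompleteSpace X]
  /-- right action of `A` -/
  ract : X → A → X
  /-- `A`-valued inner product -/
  inner : X → X → A
  /-- left action `φ : A → L(X)` by adjointable operators -/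
  lactL : A → X →L[ℂ] X
  /-- the rank-one ("compact") operators `θ_{x,y} z = x ⬝ ⟨y, z⟩` -/
  rankOne : X → X → X →L[ℂ] X
  ract_add_left : ∀ x y a, ract (x + y) a = ract x a + ract y a
  ract_add_right : ∀ x a b, ract x (a + b) = ract x a + ract x b
  ract_mul : ∀ x a b, ract x (a * b) = ract (ract x a) b
  ract_smul : ∀ (c : ℂ) x a, ract (c • x) a = c • ract x a
  ract_smul' : ∀ (c : ℂ) x a, ract x (c • a) = c • ract x a
  inner_add_right : ∀ x y z, inner x (y + z) = inner x y + inner x z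
  inner_smul_right : ∀ (c : ℂ) x y, inner x (c • y) = c • inner x y
  inner_star : ∀ x y, star (inner x y) = inner y x
  inner_ract_right : ∀ x y a, inner x (ract y a) = inner x y * a
  norm_eq : ∀ x, ‖x‖ ^ 2 = ‖inner x x‖
  lact_add : ∀ a b, lactL (a + b) = lactL a + lactL b
  lact_mul : ∀ a b, lactL (a * b) = (lactL a).comp (lactL b)
  lact_smul : ∀ (c : ℂ) a, lactL (c • a) = c • lactL a
  lact_adjoint : ∀ a x y, inner (lactL a x) y = inner x (lactL (star a) y)
  rankOne_apply : ∀ x y z, rankOne x y z = ract x (inner y z)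

attribute [instance] Corr.nacg Corr.nsp Corr.cmpl

variable {A : Type u} [NonUnitalCStarAlgebra A]

/-- Nondegeneracy: `A·X` is (topologically) all of `X`. -/
def Corr.Nondeg (W : Corr A) : Prop :=
  closure (Submodule.span ℂ {y : W.X | ∃ a x, y = W.lactL a x} : Set W.X) = Set.univ

/-- Regularity: the left action is injective and takes values in the
compact operators (the closed span of the rank-one operators). -/
def Corr.Regular (W : Corr A) : Prop :=
  (∀ a, W.lactL a = 0 → a = 0) ∧
    ∀ a, W.lactL a ∈
      closure (Submodule.span ℂ {T : W.X →L[ℂ] W.X | ∃ x y, T = W.rankOne x y} :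
        Set (W.X →L[ℂ] W.X))

/-- standing hypotheses of the paper: nondegenerate and regular -/
def Corr.Reg (W : Corr A) : Prop := W.Nondeg ∧ W.Regular

/-- a bare function which is a continuous `ℂ`-linear map -/
structure IsCLMap {E F : Type u} [NormedAddCommGroup E] [NormedSpace ℂ E]
    [NormedAddCommGroup F] [NormedSpace ℂ F] (f : E → F) : Prop where
  map_add : ∀ x y, f (x + y) = f x + f y
  map_smul : ∀ (c : ℂ) x, f (c • x) = c • f x
  cont : Continuous f

/-- a map of correspondences over the same algebra which is an isomorphism -/
structure IsCorrIsoFun (W Z : Corr A) (f : W.X → Z.X) : Prop where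
  bijective : Function.Bijective f
  map_add : ∀ x y, f (x + y) = f x + f y
  map_smul : ∀ (c : ℂ) x, f (c • x) = c • f x
  map_inner : ∀ x y, Z.inner (f x) (f y) = W.inner x y
  map_ract : ∀ x a, f (W.ract x a) = Z.ract (f x) a
  map_lact : ∀ a x, f (W.lactL a x) = Z.lactL a (f x)

/-- an isomorphism of correspondences over the same algebra (bundled) -/
structure CorrIso (W Z : Corr A) : Type u where
  toFun : W.X → Z.X
  invFun : Z.X → W.X
  left_inv : ∀ x, invFun (toFun x) = x
  right_inv : ∀ y, toFun (invFun y) = y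
  map_add : ∀ x y, toFun (x + y) = toFun x + toFun y
  map_smul : ∀ (c : ℂ) x, toFun (c • x) = c • toFun x
  map_inner : ∀ x y, Z.inner (toFun x) (toFun y) = W.inner x y
  map_ract : ∀ x a, toFun (W.ract x a) = Z.ract (toFun x) a
  map_lact : ∀ a x, toFun (W.lactL a x) = Z.lactL a (toFun x)

/-- an isomorphism of correspondences lying over an isomorphism `Φ` of the
coefficient algebras -/
structure CorrIsoOver {B : Type u} [NonUnitalCStarAlgebra B]
    (Φ : A → B) (W : Corr A) (Z : Corr B) : Type u where
  toFun : W.X → Z.X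
  bijective : Function.Bijective toFun
  map_add : ∀ x y, toFun (x + y) = toFun x + toFun y
  map_smul : ∀ (c : ℂ) x, toFun (c • x) = c • toFun x
  map_inner : ∀ x y, Z.inner (toFun x) (toFun y) = Φ (W.inner x y)
  map_ract : ∀ x a, toFun (W.ract x a) = Z.ract (toFun x) (Φ a)
  map_lact : ∀ a x, toFun (W.lactL a x) = Z.lactL (Φ a) (toFun x)

/-- `T`, together with the bilinear map `m`, is a realization of the
balanced (interior) tensor product `W ⊗_A V` of correspondences over `A`. -/
structure IsTensor (W V T : Corr A) (m : W.X → V.X → T.X) : Prop where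
  add_left : ∀ x x' y, m (x + x') y = m x y + m x' y
  add_right : ∀ x y y', m x (y + y') = m x y + m x y'
  smul_left : ∀ (c : ℂ) x y, m (c • x) y = c • m x y
  smul_right : ∀ (c : ℂ) x y, m x (c • y) = c • m x y
  balanced : ∀ x a y, m (W.ract x a) y = m x (V.lactL a y)
  inner : ∀ x y x' y',
    T.inner (m x y) (m x' y') = V.inner y (V.lactL (W.inner x x') y')
  ract : ∀ x y a, T.ract (m x y) a = m x (V.ract y a)
  lact : ∀ a x y, T.lactL a (m x y) = m (W.lactL a x) y
  dense : closure (Submodule.span ℂ {z : T.X | ∃ x y, z = m x y} : Set T.X) = Set.univ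

variable {B : Type u} [NonUnitalCStarAlgebra B]

/-- `π : A → B` is a *-homomorphism (stated elementwise) -/
structure IsStarHom (π : A → B) : Prop where
  map_add : ∀ a b, π (a + b) = π a + π b
  map_mul : ∀ a b, π (a * b) = π a * π b
  map_star : ∀ a, π (star a) = star (π a)
  map_smul : ∀ (c : ℂ) a, π (c • a) = c • π a

/-- `(π, t)` is a representation (Toeplitz representation) of the
correspondence `W` in the C*-algebra `B`. -/
structure IsRep (W : Corr A) (π : A → B) (t : W.X → B) : Prop where
  hom : IsStarHom π
  t_add : ∀ x y, t (x + y) = t x + t y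
  t_smul : ∀ (c : ℂ) x, t (c • x) = c • t x
  lact : ∀ a x, t (W.lactL a x) = π a * t x
  ract : ∀ x a, t (W.ract x a) = t x * π a
  inner : ∀ x y, star (t x) * t y = π (W.inner x y)

/-- Cuntz–Pimsner covariance of a representation of a *regular*
correspondence: whenever `φ(a)` is approximated in norm by finite sums of
rank-one operators `θ_{x,y}`, `π(a)` is approximated by the corresponding
sums `t(x) t(y)*`.  (For regular correspondences this is equivalent to
`π = t⁽¹⁾ ∘ φ`.) -/
def CPCov (W : Corr A) (π : A → B) (t : W.X → B) : Prop :=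
  ∀ (a : A) (N : ℕ → ℕ) (x y : ∀ n, Fin (N n) → W.X),
    Tendsto (fun n => ∑ r, W.rankOne (x n r) (y n r)) atTop (𝓝 (W.lactL a)) →
    Tendsto (fun n => ∑ r, t (x n r) * star (t (y n r))) atTop (𝓝 (π a))

/-- The Cuntz–Pimsner algebra of a correspondence `W`: a C*-algebra `O`
together with a universal covariant representation `(π, t)`:  `(π,t)` is
covariant, `π` is injective, `O` is generated by the images of `π` and `t`,
and every covariant representation factors uniquely through `O`. -/
structure CPAlg (W : Corr A) : Type (u + 1) where
  O : Type u
  [alg : NonUnitalCStarAlgebra O]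
  π : A → O
  t : W.X → O
  isRep : IsRep W π t
  covariant : CPCov W π t
  inj : Function.Injective π
  gen : ∀ S : Set O, IsClosed S →
    (∀ a, π a ∈ S) → (∀ x, t x ∈ S) →
    (∀ p q, p ∈ S → q ∈ S → p + q ∈ S) →
    (∀ p q, p ∈ S → q ∈ S → p * q ∈ S) →
    (∀ (c : ℂ) p, p ∈ S → c • p ∈ S) →
    (∀ p, p ∈ S → star p ∈ S) → ∀ z, z ∈ S
  universal : ∀ (C : Type u) [NonUnitalCStarAlgebra C],
    ∀ (π' : A → C) (t' : W.X → C), IsRep W π' t' → CPCov W π' t' →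
      ∃! h : O →⋆ₙₐ[ℂ] C, (∀ a, h (π a) = π' a) ∧ ∀ x, h (t x) = t' x

attribute [instance] CPAlg.alg

/- ##################  product systems over ℕ^k  ################## -/

/-- the `i`-th standard generator of `ℕ^k` -/
def egen {k : ℕ} (i : Fin k) : Fin k → ℕ := Pi.single i 1

/-- A product system over `ℕ^k` of (nondegenerate regular) correspondences
over `A`:  fibers `fib s`, an associative multiplication implementing
isomorphisms `fib s ⊗_A fib t ≅ fib (s+t)`, and `fib 0 = A` (witnessed by
the unit map). -/
structure PSys (A : Type u) [NonUnitalCStarAlgebra A] (k : ℕ) : Type (u + 1) where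
  fib : (Fin k → ℕ) → Corr A
  reg : ∀ s, (fib s).Reg
  mul : ∀ s t, (fib s).X → (fib t).X → (fib (s + t)).X
  isTensor : ∀ s t, IsTensor (fib s) (fib t) (fib (s + t)) (mul s t)
  assoc : ∀ s t u x y z,
    HEq (mul (s + t) u (mul s t x y) z) (mul s (t + u) x (mul t u y z))
  unit : A → (fib 0).X
  unit_bij : Function.Bijective unit
  unit_add : ∀ a b, unit (a + b) = unit a + unit b
  unit_smul : ∀ (c : ℂ) a, unit (c • a) = c • unit a
  unit_inner : ∀ a b, (fib 0).inner (unit a) (unit b) = star a * b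
  unit_lact : ∀ a b, (fib 0).lactL a (unit b) = unit (a * b)
  unit_ract : ∀ a b, (fib 0).ract (unit a) b = unit (a * b)
  unit_mul_left : ∀ s a x, HEq (mul 0 s (unit a) x) ((fib s).lactL a x)
  unit_mul_right : ∀ s x a, HEq (mul s 0 x (unit a)) ((fib s).ract x a)

/-- a representation of a product system in a C*-algebra `B` -/
structure PSRep {k : ℕ} (Xs : PSys A k) (B : Type u) [NonUnitalCStarAlgebra B] :
    Type u where
  π : A → B
  ψ : ∀ s, (Xs.fib s).X → B
  isRep : ∀ s, IsRep (Xs.fib s) π (ψ s)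
  ψ_zero : ∀ a, ψ 0 (Xs.unit a) = π a
  mul : ∀ s t x y, ψ s x * ψ t y = ψ (s + t) (Xs.mul s t x y)

/-- Cuntz–Pimsner covariance of a representation of a product system -/
def PSCPCov {k : ℕ} {Xs : PSys A k} {B : Type u} [NonUnitalCStarAlgebra B]
    (r : PSRep Xs B) : Prop :=
  ∀ s, CPCov (Xs.fib s) r.π (r.ψ s)

/-- The Cuntz–Pimsner algebra `𝒪(X)` of a product system. -/
structure PSCPAlg {k : ℕ} (Xs : PSys A k) : Type (u + 1) where
  O : Type u
  [alg : NonUnitalCStarAlgebra O]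
  rep : PSRep Xs O
  covariant : PSCPCov rep
  inj : Function.Injective rep.π
  gen : ∀ S : Set O, IsClosed S →
    (∀ a, rep.π a ∈ S) → (∀ s x, rep.ψ s x ∈ S) →
    (∀ p q, p ∈ S → q ∈ S → p + q ∈ S) →
    (∀ p q, p ∈ S → q ∈ S → p * q ∈ S) →
    (∀ (c : ℂ) p, p ∈ S → c • p ∈ S) →
    (∀ p, p ∈ S → star p ∈ S) → ∀ z, z ∈ S
  universal : ∀ (C : Type u) [NonUnitalCStarAlgebra C],
    ∀ r : PSRep Xs C, PSCPCov r →
      ∃! h : O →⋆ₙₐ[ℂ] C,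
        (∀ a, h (rep.π a) = r.π a) ∧ ∀ s x, h (rep.ψ s x) = r.ψ s x

attribute [instance] PSCPAlg.alg

/- ##################  generating systems  ################## -/

/-- a realization of a triple tensor product `W1 ⊗ W2 ⊗ W3` carrying both
a left pairing `(W1 ⊗ W2) ⊗ W3` and a right pairing `W1 ⊗ (W2 ⊗ W3)` -/
structure Trip (W1 W2 W3 : Corr A) (T12 : Corr A) (m12 : W1.X → W2.X → T12.X)
    (T23 : Corr A) (m23 : W2.X → W3.X → T23.X) (P : Corr A) : Type u where
  lp : T12.X → W3.X → P.X
  rp : W1.X → T23.X → P.X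
  lt : IsTensor T12 W3 P lp
  rt : IsTensor W1 T23 P rp
  compat : ∀ x y z, lp (m12 x y) z = rp x (m23 y z)

/-- the hexagonal relation for a triple of flip isomorphisms
`θij, θil, θjl`, stated relative to arbitrary realizations of the six
triple tensor products. -/
def HexProp (Yi Yj Yl : Corr A)
    (Tij Tji Til Tli Tjl Tlj : Corr A)
    (mij : Yi.X → Yj.X → Tij.X) (mji : Yj.X → Yi.X → Tji.X)
    (mil : Yi.X → Yl.X → Til.X) (mli : Yl.X → Yi.X → Tli.X)
    (mjl : Yj.X → Yl.X → Tjl.X) (mlj : Yl.X → Yj.X → Tlj.X)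
    (θij : Tij.X → Tji.X) (θil : Til.X → Tli.X) (θjl : Tjl.X → Tlj.X) : Prop :=
  ∀ (P1 P2 P3 P4 P5 P6 : Corr A)
    (R1 : Trip Yi Yj Yl Tij mij Tjl mjl P1)
    (R2 : Trip Yj Yi Yl Tji mji Til mil P2)
    (R3 : Trip Yj Yl Yi Tjl mjl Tli mli P3)
    (R4 : Trip Yl Yj Yi Tlj mlj Tji mji P4)
    (R5 : Trip Yi Yl Yj Til mil Tlj mlj P5)
    (R6 : Trip Yl Yi Yj Tli mli Tij mij P6)
    (F1 : P1.X → P2.X) (F2 : P2.X → P3.X) (F3 : P3.X → P4.X)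
    (F4 : P1.X → P5.X) (F5 : P5.X → P6.X) (F6 : P6.X → P4.X),
    IsCLMap F1 → IsCLMap F2 → IsCLMap F3 →
    IsCLMap F4 → IsCLMap F5 → IsCLMap F6 →
    (∀ u z, F1 (R1.lp u z) = R2.lp (θij u) z) →
    (∀ y v, F2 (R2.rp y v) = R3.rp y (θil v)) →
    (∀ u z, F3 (R3.lp u z) = R4.lp (θjl u) z) →
    (∀ x v, F4 (R1.rp x v) = R5.rp x (θjl v)) →
    (∀ u z, F5 (R5.lp u z) = R6.lp (θil u) z) →
    (∀ x v, F6 (R6.rp x v) = R4.rp x (θij v)) →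
    ∀ w, F3 (F2 (F1 w)) = F6 (F5 (F4 w))

/-- A generating system `(Y, θ)` of `k` correspondences over `A`:
correspondences `Y i`, chosen realizations `T i j` of the tensor products
`Y i ⊗_A Y j`, and flip isomorphisms `θ i j : Y i ⊗ Y j → Y j ⊗ Y i` with
`θ i i = id`, `θ j i = (θ i j)⁻¹`, satisfying the hexagonal relations. -/
structure GenSys (A : Type u) [NonUnitalCStarAlgebra A] (k : ℕ) : Type (u + 1) where
  Y : Fin k → Corr A
  reg : ∀ i, (Y i).Reg
  T : Fin k → Fin k → Corr A
  tmul : ∀ i j, (Y i).X → (Y j).X → (T i j).X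
  isTensor : ∀ i j, IsTensor (Y i) (Y j) (T i j) (tmul i j)
  θ : ∀ i j, CorrIso (T i j) (T j i)
  θ_diag : ∀ i x y, (θ i i).toFun (tmul i i x y) = tmul i i x y
  θ_symm : ∀ i j z, (θ j i).toFun ((θ i j).toFun z) = z
  hex : ∀ i j l, HexProp (Y i) (Y j) (Y l) (T i j) (T j i) (T i l) (T l i)
    (T j l) (T l j) (tmul i j) (tmul j i) (tmul i l) (tmul l i) (tmul j l)
    (tmul l j) ((θ i j).toFun) ((θ i l).toFun) ((θ j l).toFun)

/-- the generating system obtained by keeping only `Y 1, …, Y m` -/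
def GenSys.restrict {k : ℕ} (G : GenSys A k) (m : ℕ) (h : m ≤ k) : GenSys A m where
  Y i := G.Y (Fin.castLE h i)
  reg i := G.reg _
  T i j := G.T (Fin.castLE h i) (Fin.castLE h j)
  tmul i j := G.tmul _ _
  isTensor i j := G.isTensor _ _
  θ i j := G.θ _ _
  θ_diag i := G.θ_diag _
  θ_symm i j := G.θ_symm _ _
  hex i j l := G.hex _ _ _

/-- `X` is *the* product system (over `ℕ^k`) generated by the generating
system `G` (Fowler–Sims); witnessed by compatible isomorphisms on the
generating fibers. -/
structure Generates {k : ℕ} (G : GenSys A k) (Xs : PSys A k) : Type u where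
  ι : ∀ i, CorrIso (G.Y i) (Xs.fib (egen i))
  κ : ∀ i j, CorrIso (G.T i j) (Xs.fib (egen i + egen j))
  κ_mul : ∀ i j x y,
    (κ i j).toFun (G.tmul i j x y) =
      Xs.mul (egen i) (egen j) ((ι i).toFun x) ((ι j).toFun y)
  θ_compat : ∀ i j z,
    HEq ((κ j i).toFun ((G.θ i j).toFun z)) ((κ i j).toFun z)

/- ############  mixed tensor products `W ⊗_A O` and `W ⊗_A V`  ############ -/

/-- `Z` (a correspondence over the C*-algebra `O`), with map `m`, is a
realization of the right Hilbert `O`-module `W ⊗_A O`, where `O` is an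
`A`-algebra via `πA`.  (No condition on the left action of `O` on `Z`.) -/
structure MixedMod (W : Corr A) (O : Type u) [NonUnitalCStarAlgebra O]
    (πA : A → O) (Z : Corr O) (m : W.X → O → Z.X) : Prop where
  add_left : ∀ x x' S, m (x + x') S = m x S + m x' S
  add_right : ∀ x S S', m x (S + S') = m x S + m x S'
  smul_left : ∀ (c : ℂ) x S, m (c • x) S = c • m x S
  smul_right : ∀ (c : ℂ) x S, m x (c • S) = c • m x S
  balanced : ∀ x a S, m (W.ract x a) S = m x (πA a * S)
  ract : ∀ x S T, Z.ract (m x S) T = m x (S * T)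
  inner : ∀ x S y T, Z.inner (m x S) (m y T) = star S * (πA (W.inner x y) * T)
  dense : closure (Submodule.span ℂ {z : Z.X | ∃ x S, z = m x S} : Set Z.X) = Set.univ

/-- `P`, with pairing `p`, is a realization of the balanced tensor product
`W ⊗_A V` where `W` is a correspondence over `A` and `V` a correspondence
over the `A`-algebra `O` (via `πA`); the left `A`-action is `πA`-compatible. -/
structure MixedPair (W : Corr A) {O : Type u} [NonUnitalCStarAlgebra O]
    (πA : A → O) (V P : Corr O) (p : W.X → V.X → P.X) : Prop where
  add_left : ∀ x x' v, p (x + x') v = p x v + p x' v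
  add_right : ∀ x v v', p x (v + v') = p x v + p x v'
  smul_left : ∀ (c : ℂ) x v, p (c • x) v = c • p x v
  smul_right : ∀ (c : ℂ) x v, p x (c • v) = c • p x v
  balanced : ∀ x a v, p (W.ract x a) v = p x (V.lactL (πA a) v)
  inner : ∀ x v x' v',
    P.inner (p x v) (p x' v') = V.inner v (V.lactL (πA (W.inner x x')) v')
  ract : ∀ x v S, P.ract (p x v) S = p x (V.ract v S)
  lact_pi : ∀ a x v, P.lactL (πA a) (p x v) = p (W.lactL a x) v
  dense : closure (Submodule.span ℂ {z : P.X | ∃ x v, z = p x v} : Set P.X) = Set.univ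

/- ############  the correspondence `ℰYᵢ = Yᵢ ⊗_A 𝒪(Y₁)`  ############ -/

/-- `Z = Yi ⊗_A 𝒪(Y1)` with the left `𝒪(Y1)`-action determined by the flip
`θ : Y1 ⊗ Yi → Yi ⊗ Y1` (`T` and `T'` are realizations of these tensor
products):  `π(a)` acts by `φ(a) ⊗ 1`, and `t(x)·(y ⊗ S) = (1 ⊗ V)(θ ⊗ 1)
(x ⊗ y ⊗ S)`. -/
structure ECorrData (Y1 Yi : Corr A)
    (T : Corr A) (mT : Y1.X → Yi.X → T.X)
    (T' : Corr A) (mT' : Yi.X → Y1.X → T'.X)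
    (θ : T.X → T'.X)
    (C : CPAlg Y1) (Z : Corr C.O) (m : Yi.X → C.O → Z.X) : Prop where
  mod : MixedMod Yi C.O C.π Z m
  lact_pi : ∀ a y S, Z.lactL (C.π a) (m y S) = m (Yi.lactL a y) S
  lact_t : ∃ μ : T'.X → C.O → Z.X,
    (∀ S, IsCLMap fun u => μ u S) ∧
    (∀ y u S, μ (mT' y u) S = m y (C.t u * S)) ∧
    ∀ x y S, Z.lactL (C.t x) (m y S) = μ (θ (mT x y)) S

/-- `Z = Yi ⊗_A 𝒪(Y p)` for a generating system `G`, with left action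
determined by `θ p i` -/
def ECorr {k : ℕ} (G : GenSys A k) (p i : Fin k) (C : CPAlg (G.Y p))
    (Z : Corr C.O) (m : (G.Y i).X → C.O → Z.X) : Prop :=
  ECorrData (G.Y p) (G.Y i) (G.T p i) (G.tmul p i) (G.T i p) (G.tmul i p)
    ((G.θ p i).toFun) C Z m

/-- `Z = Y j ⊗_A 𝒪(Y 1 ∗ ⋯ ∗ Y m)` with the left action of the
Cuntz–Pimsner algebra of the product system determined on the generators
`σ i = ψ_{e i}` via the flips `θ i j` and the absorption maps. -/
structure EPCorr {k : ℕ} (G : GenSys A k) {m : ℕ} (hm : m ≤ k)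
    (Xs : PSys A m) (gen : Generates (G.restrict m hm) Xs) (C : PSCPAlg Xs)
    (j : Fin k) (Z : Corr C.O) (mm : (G.Y j).X → C.O → Z.X) : Prop where
  mod : MixedMod (G.Y j) C.O C.rep.π Z mm
  lact_pi : ∀ a y S, Z.lactL (C.rep.π a) (mm y S) = mm ((G.Y j).lactL a y) S
  lact_t : ∀ i : Fin m,
    ∃ μ : (G.T j (Fin.castLE hm i)).X → C.O → Z.X,
      (∀ S, IsCLMap fun u => μ u S) ∧
      (∀ y u S, μ (G.tmul j (Fin.castLE hm i) y u) S =
        mm y (C.rep.ψ (egen i) ((gen.ι i).toFun u) * S)) ∧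
      ∀ x y S, Z.lactL (C.rep.ψ (egen i) ((gen.ι i).toFun x)) (mm y S) =
        μ ((G.θ (Fin.castLE hm i) j).toFun (G.tmul (Fin.castLE hm i) j x y)) S

/- ############  the isomorphism `ℛθ = ν⁻¹ (θ ⊗ 1) ν`  ############ -/

/-- Witness data expressing that `R : Zi ⊗_O Zj → Zj ⊗_O Zi` is the map
`ℛθ_{ij} = ν_{ji}⁻¹ (θ_{ij} ⊗ 1_O) ν_{ij}` of the paper, where
`Zi = Yi ⊗_A O`, `O = 𝒪(Y1)`, and `ν_{ij} : (Yi ⊗ O) ⊗_O (Yj ⊗ O) ≅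
Yi ⊗ Yj ⊗ O` is the canonical absorption isomorphism. -/
structure RTheta (O : Type u) [NonUnitalCStarAlgebra O] (πA : A → O)
    (Yi Yj : Corr A) (Tij Tji : Corr A)
    (mij : Yi.X → Yj.X → Tij.X) (mji : Yj.X → Yi.X → Tji.X)
    (θij : Tij.X → Tji.X)
    (Zi Zj : Corr O) (mmi : Yi.X → O → Zi.X) (mmj : Yj.X → O → Zj.X)
    (TZ TZr : Corr O) (mZ : Zi.X → Zj.X → TZ.X) (mZr : Zj.X → Zi.X → TZr.X)
    (R : TZ.X → TZr.X) : Type (u + 1) where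
  Pl : Corr O
  Pr : Corr O
  pij : Yi.X → Zj.X → Pl.X
  pji : Yj.X → Zi.X → Pr.X
  hp : MixedPair Yi πA Zj Pl pij
  hpr : MixedPair Yj πA Zi Pr pji
  q : Tij.X → O → Pl.X
  qr : Tji.X → O → Pr.X
  hq : MixedMod Tij O πA Pl q
  hqr : MixedMod Tji O πA Pr qr
  q_compat : ∀ x y S, q (mij x y) S = pij x (mmj y S)
  q_compatr : ∀ y x S, qr (mji y x) S = pji y (mmi x S)
  ν : TZ.X → Pl.X
  νr : TZr.X → Pr.X
  hν : IsCLMap ν ∧ Function.Bijective ν ∧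
    ∀ x S ζ, ν (mZ (mmi x S) ζ) = pij x (Zj.lactL S ζ)
  hνr : IsCLMap νr ∧ Function.Bijective νr ∧
    ∀ y S ζ, νr (mZr (mmj y S) ζ) = pji y (Zi.lactL S ζ)
  Θ : Pl.X → Pr.X
  hΘ : IsCLMap Θ ∧ ∀ u S, Θ (q u S) = qr (θij u) S
  hR : ∀ z, νr (R z) = Θ (ν z)

section DenseLinear

variable {E F H : Type u} [NormedAddCommGroup E] [NormedSpace ℂ E]
  [NormedAddCommGroup F] [NormedSpace ℂ F] [NormedAddCommGroup H] [NormedSpace ℂ H]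

theorem IsCLMap.of_bound {f : E → F} (hadd : ∀ x y, f (x + y) = f x + f y)
    (hsmul : ∀ (c : ℂ) x, f (c • x) = c • f x) (C : ℝ) (h : ∀ x, ‖f x‖ ≤ C * ‖x‖) :
    IsCLMap f :=
  ⟨hadd, hsmul, AddMonoidHomClass.continuous_of_bound (AddMonoidHom.mk' f hadd) C h⟩

theorem ContinuousLinearMap.isCLMap (f : E →L[ℂ] F) : IsCLMap f :=
  ⟨f.map_add, f.map_smul, f.continuous⟩

theorem IsCLMap.id : IsCLMap (fun x : E => x) := ⟨fun _ _ => rfl, fun _ _ => rfl, continuous_id⟩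

theorem IsCLMap.comp {g : F → H} {f : E → F} (hg : IsCLMap g) (hf : IsCLMap f) :
    IsCLMap fun x => g (f x) :=
  ⟨fun x y => by rw [hf.map_add, hg.map_add], fun c x => by rw [hf.map_smul, hg.map_smul],
    hg.cont.comp hf.cont⟩

theorem IsCLMap.map_zero {f : E → F} (hf : IsCLMap f) : f 0 = 0 := by
  simpa using hf.map_smul 0 0

theorem dense_span_induction {S : Set E} (hS : closure (Submodule.span ℂ S : Set E) = Set.univ)
    {P : E → Prop} (hc : IsClosed {x | P x}) (hmem : ∀ x ∈ S, P x) (hzero : P 0)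
    (hadd : ∀ x y, P x → P y → P (x + y)) (hsmul : ∀ (c : ℂ) x, P x → P (c • x)) (x : E) :
    P x := by
  have hx : x ∈ closure (Submodule.span ℂ S : Set E) := hS ▸ Set.mem_univ x
  refine (closure_minimal (fun y hy => ?_) hc) hx
  exact Submodule.span_induction (p := fun z _ => P z) hmem hzero
    (fun _ _ _ _ => hadd _ _) (fun _ _ _ => hsmul _ _) hy

theorem IsCLMap.eq_of_dense {S : Set E}
    (hS : closure (Submodule.span ℂ S : Set E) = Set.univ) {f g : E → F}
    (hf : IsCLMap f) (hg : IsCLMap g) (h : ∀ x ∈ S, f x = g x) (x : E) : f x = g x :=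
  dense_span_induction hS (isClosed_eq hf.cont hg.cont) h (by rw [hf.map_zero, hg.map_zero])
    (fun x y hx hy => by rw [hf.map_add, hg.map_add, hx, hy])
    (fun c x hx => by rw [hf.map_smul, hg.map_smul, hx]) x

/-- A linear map prescribed on a total family extends by continuity as soon as it is
contractive on linear combinations. -/
theorem exists_isCLMap_of_total [CompleteSpace F] {ι : Type*} (v : ι → E) (w : ι → F)
    (hv : closure (Submodule.span ℂ (Set.range v) : Set E) = Set.univ)
    (hb : ∀ c : ι →₀ ℂ,
      ‖Finsupp.linearCombination ℂ w c‖ ≤ ‖Finsupp.linearCombination ℂ v c‖) :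
    ∃ f : E → F, IsCLMap f ∧ ∀ i, f (v i) = w i := by
  have hd : DenseRange (Finsupp.linearCombination ℂ v) := by
    rw [DenseRange, dense_iff_closure_eq, ← hv, ← LinearMap.coe_range,
      Finsupp.range_linearCombination]
  have hC : ∃ C, ∀ c, ‖Finsupp.linearCombination ℂ w c‖ ≤ C * ‖Finsupp.linearCombination ℂ v c‖ :=
    ⟨1, fun c => by simpa using hb c⟩
  refine ⟨_, ((Finsupp.linearCombination ℂ w).extendOfNorm
    (Finsupp.linearCombination ℂ v)).isCLMap, fun i => ?_⟩
  have := LinearMap.extendOfNorm_eq hd hC (Finsupp.single i 1)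
  simpa using this

end DenseLinear

section StarHom

theorem IsStarHom.map_zero {π : A → B} (h : IsStarHom π) : π 0 = 0 := by
  simpa using h.map_smul 0 0

/-- The bundled homomorphism underlying an elementwise *-homomorphism. -/
def IsStarHom.toHom {π : A → B} (h : IsStarHom π) : A →⋆ₙₐ[ℂ] B where
  toFun := π
  map_smul' := h.map_smul
  map_zero' := h.map_zero
  map_add' := h.map_add
  map_mul' := h.map_mul
  map_star' := h.map_star

theorem NonUnitalStarAlgHom.isStarHom (f : A →⋆ₙₐ[ℂ] B) : IsStarHom f :=
  ⟨map_add f, map_mul f, map_star f, map_smul f⟩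

theorem IsStarHom.comp {C : Type u} [NonUnitalCStarAlgebra C] {ρ : B → C} {π : A → B}
    (hρ : IsStarHom ρ) (hπ : IsStarHom π) : IsStarHom fun a => ρ (π a) :=
  (hρ.toHom.comp hπ.toHom).isStarHom

theorem IsStarHom.norm_le {π : A → B} (h : IsStarHom π) (a : A) : ‖π a‖ ≤ ‖a‖ :=
  NonUnitalStarAlgHom.norm_apply_le h.toHom a

theorem IsStarHom.norm_eq {π : A → B} (h : IsStarHom π) (hi : Function.Injective π) (a : A) :
    ‖π a‖ = ‖a‖ :=
  NonUnitalStarAlgHom.norm_map h.toHom hi a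

theorem IsStarHom.isCLMap {π : A → B} (h : IsStarHom π) : IsCLMap π :=
  .of_bound h.map_add h.map_smul 1 fun a => by simpa using h.norm_le a

theorem isCLMap_mul_left (b : B) : IsCLMap fun x => b * x :=
  .of_bound (mul_add b) (fun c x => mul_smul_comm c b x) ‖b‖ fun x => norm_mul_le b x

theorem isCLMap_mul_right (b : B) : IsCLMap fun x => x * b :=
  .of_bound (fun x y => add_mul x y b) (fun c x => smul_mul_assoc c x b) ‖b‖
    fun x => by rw [mul_comm ‖b‖]; exact norm_mul_le x b

end StarHom

namespace Corr

variable (W : Corr A)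

theorem inner_add_left (x y z : W.X) : W.inner (x + y) z = W.inner x z + W.inner y z := by
  rw [← W.inner_star z, W.inner_add_right, star_add, W.inner_star, W.inner_star]

theorem inner_smul_left (c : ℂ) (x y : W.X) : W.inner (c • x) y = star c • W.inner x y := by
  rw [← W.inner_star y, W.inner_smul_right, star_smul, W.inner_star]

theorem inner_ract_left (x : W.X) (a : A) (y : W.X) :
    W.inner (W.ract x a) y = star a * W.inner x y := by
  rw [← W.inner_star y, W.inner_ract_right, star_mul, W.inner_star]

theorem inner_sub_right (x y z : W.X) : W.inner x (y - z) = W.inner x y - W.inner x z := by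
  rw [sub_eq_add_neg, W.inner_add_right, ← neg_one_smul ℂ z, W.inner_smul_right, neg_one_smul,
    sub_eq_add_neg]

theorem inner_sub_left (x y z : W.X) : W.inner (x - y) z = W.inner x z - W.inner y z := by
  rw [← W.inner_star z, W.inner_sub_right, star_sub, W.inner_star, W.inner_star]

theorem inner_sum_right {ι : Type*} (s : Finset ι) (x : W.X) (f : ι → W.X) :
    W.inner x (∑ i ∈ s, f i) = ∑ i ∈ s, W.inner x (f i) :=
  map_sum (AddMonoidHom.mk' (W.inner x) (W.inner_add_right x)) f s

theorem inner_sum_left {ι : Type*} (s : Finset ι) (f : ι → W.X) (x : W.X) :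
    W.inner (∑ i ∈ s, f i) x = ∑ i ∈ s, W.inner (f i) x :=
  map_sum (AddMonoidHom.mk' (W.inner · x) fun y z => W.inner_add_left y z x) f s

/-- The boundedness of the module operations; it is automatic for genuine Hilbert modules and
follows from the existence of a faithful representation. -/
structure Tame (W : Corr A) : Prop where
  inner_le : ∀ x y, ‖W.inner x y‖ ≤ ‖x‖ * ‖y‖
  ract_le : ∀ x a, ‖W.ract x a‖ ≤ ‖x‖ * ‖a‖
  lact_le : ∀ a x, ‖W.lactL a x‖ ≤ ‖a‖ * ‖x‖

variable {W}

theorem Tame.inner_right (h : W.Tame) (x : W.X) : IsCLMap fun y => W.inner x y :=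
  .of_bound (W.inner_add_right x) (fun c y => W.inner_smul_right c x y) ‖x‖ (h.inner_le x)

theorem Tame.ract_left (h : W.Tame) (a : A) : IsCLMap fun x => W.ract x a :=
  .of_bound (fun x y => W.ract_add_left x y a) (fun c x => W.ract_smul c x a) ‖a‖
    fun x => by rw [mul_comm ‖a‖]; exact h.ract_le x a

theorem Tame.lact_left (h : W.Tame) (x : W.X) : IsCLMap fun a => W.lactL a x :=
  .of_bound (fun a b => by rw [W.lact_add]; rfl) (fun c a => by rw [W.lact_smul]; rfl) ‖x‖
    fun a => by rw [mul_comm ‖x‖]; exact h.lact_le a x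

end Corr

namespace IsRep

variable {W : Corr A} {π : A → B} {t : W.X → B}

theorem norm_le (h : IsRep W π t) (x : W.X) : ‖t x‖ ≤ ‖x‖ := by
  have h1 : ‖t x‖ * ‖t x‖ ≤ ‖x‖ * ‖x‖ := by
    rw [← CStarRing.norm_star_mul_self, h.inner, ← sq ‖x‖, W.norm_eq]
    exact h.hom.norm_le _
  exact abs_le_of_sq_le_sq' (by simpa [sq] using h1) (norm_nonneg x) |>.2

theorem norm_eq (h : IsRep W π t) (hi : Function.Injective π) (x : W.X) : ‖t x‖ = ‖x‖ := by
  have h1 : ‖t x‖ ^ 2 = ‖x‖ ^ 2 := by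
    rw [sq ‖t x‖, ← CStarRing.norm_star_mul_self, h.inner, W.norm_eq]
    exact h.hom.norm_eq hi _
  exact (sq_eq_sq₀ (norm_nonneg _) (norm_nonneg _)).1 h1

theorem isCLMap (h : IsRep W π t) : IsCLMap t :=
  .of_bound h.t_add h.t_smul 1 fun x => by simpa using h.norm_le x

theorem tame (h : IsRep W π t) (hi : Function.Injective π) : W.Tame where
  inner_le x y := by
    rw [← h.hom.norm_eq hi, ← h.inner, ← h.norm_eq hi x, ← h.norm_eq hi y, ← norm_star (t x)]
    exact norm_mul_le _ _
  ract_le x a := by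
    rw [← h.norm_eq hi, h.ract, ← h.norm_eq hi x, ← h.hom.norm_eq hi a]
    exact norm_mul_le _ _
  lact_le a x := by
    rw [← h.norm_eq hi, h.lact, ← h.norm_eq hi x, ← h.hom.norm_eq hi a]
    exact norm_mul_le _ _

theorem comp {C : Type u} [NonUnitalCStarAlgebra C] {ρ : B → C} (hρ : IsStarHom ρ)
    (h : IsRep W π t) : IsRep W (fun a => ρ (π a)) (fun x => ρ (t x)) where
  hom := hρ.comp h.hom
  t_add x y := by rw [h.t_add, hρ.map_add]
  t_smul c x := by rw [h.t_smul, hρ.map_smul]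
  lact a x := by rw [h.lact, hρ.map_mul]
  ract x a := by rw [h.ract, hρ.map_mul]
  inner x y := by rw [← hρ.map_star, ← hρ.map_mul, h.inner]

end IsRep

section ApproximateUnit

variable (A) in
theorem dense_span_mul :
    closure (Submodule.span ℂ {c : A | ∃ a b, c = a * b} : Set A) = Set.univ := by
  let _ := CStarAlgebra.spectralOrder A
  have := CStarAlgebra.spectralOrderedRing A
  have hl := CStarAlgebra.increasingApproximateUnit A
  have := hl.neBot
  refine Set.eq_univ_of_forall fun a => mem_closure_of_tendsto (hl.tendsto_mul_left a) ?_
  exact .of_forall fun e => Submodule.subset_span ⟨a, e, rfl⟩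

theorem Corr.dense_span_ract (W : Corr A) :
    closure (Submodule.span ℂ {y : W.X | ∃ x a, y = W.ract x a} : Set W.X) = Set.univ := by
  let _ := CStarAlgebra.spectralOrder A
  have := CStarAlgebra.spectralOrderedRing A
  have hl := CStarAlgebra.increasingApproximateUnit A
  have := hl.neBot
  refine Set.eq_univ_of_forall fun x => ?_
  suffices Tendsto (fun e => W.ract x e) (CStarAlgebra.approximateUnit A) (𝓝 x) from
    mem_closure_of_tendsto this (.of_forall fun e => Submodule.subset_span ⟨x, e, rfl⟩)
  have h1 : Tendsto (fun e => 2 * ‖W.inner x x - W.inner x x * e‖)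
      (CStarAlgebra.approximateUnit A) (𝓝 0) := by
    have := (((tendsto_const_nhds (x := W.inner x x)).sub
      (hl.tendsto_mul_left (W.inner x x))).norm).const_mul (2 : ℝ)
    simpa using this
  have h2 : Tendsto (fun e => ‖W.ract x e - x‖ ^ 2) (CStarAlgebra.approximateUnit A) (𝓝 0) := by
    refine squeeze_zero' (.of_forall fun e => sq_nonneg _) ?_ h1
    filter_upwards [hl.eventually_norm] with e he
    have : W.inner (W.ract x e - x) (W.ract x e - x) =
        (W.inner x x - W.inner x x * e) - star e * (W.inner x x - W.inner x x * e) := by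
      simp only [inner_sub_left, inner_sub_right, inner_ract_left, inner_ract_right, mul_sub,
        sub_mul, mul_assoc]
      abel
    rw [W.norm_eq, this]
    refine (norm_sub_le _ _).trans ?_
    have h3 : ‖star e * (W.inner x x - W.inner x x * e)‖ ≤
        1 * ‖W.inner x x - W.inner x x * e‖ :=
      (norm_mul_le _ _).trans (by rw [norm_star]; gcongr)
    linarith
  rw [tendsto_iff_norm_sub_tendsto_zero]
  simpa using h2.sqrt

end ApproximateUnit

section Squares

theorem le_mul_of_sq_le_mul_succ {b : ℕ → ℝ} {K C r : ℝ} (hb : ∀ j, 0 ≤ b j) (hK : 0 ≤ K)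
    (hr : 0 ≤ r) (hsq : ∀ j, b j ^ 2 ≤ K * b (j + 1)) (hC : ∀ j, b j ≤ C * r ^ (2 ^ j)) :
    b 0 ≤ K * r := by
  rcases hK.eq_or_lt with rfl | hK
  · have := hsq 0
    nlinarith [hb 0]
  by_contra! hlt
  have hu : r < b 0 / K := by rwa [lt_div_iff₀' hK]
  have hpow : ∀ j, (b 0 / K) ^ (2 ^ j) ≤ b j / K := by
    intro j
    induction j with
    | zero => simp
    | succ j ih =>
      rw [pow_succ, pow_mul]
      calc ((b 0 / K) ^ 2 ^ j) ^ 2 ≤ (b j / K) ^ 2 := by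
            gcongr
            exact pow_nonneg (div_nonneg (hb 0) hK.le) _
        _ ≤ b (j + 1) / K := by
            rw [div_pow, div_le_div_iff₀ (by positivity) hK]
            nlinarith [hsq j]
  have hle : ∀ j, (b 0 / K) ^ (2 ^ j) ≤ C / K * r ^ (2 ^ j) := fun j =>
    (hpow j).trans (by rw [div_mul_eq_mul_div]; gcongr; exact hC j)
  rcases hr.eq_or_lt with rfl | hr
  · have := hle 0
    simp at this
    linarith
  have hq : 1 < b 0 / K / r := by rwa [one_lt_div hr]
  obtain ⟨n, hn⟩ := pow_unbounded_of_one_lt (C / K) hq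
  have h1 : (b 0 / K / r) ^ n ≤ (b 0 / K / r) ^ (2 ^ n) :=
    pow_le_pow_right₀ hq.le n.lt_two_pow_self.le
  have h2 : (b 0 / K / r) ^ (2 ^ n) ≤ C / K := by
    rw [div_pow, div_le_iff₀ (by positivity)]
    exact hle n
  linarith

end Squares

section Ideal

variable {W : Corr A} {π : A → B} {t : W.X → B}

/-- The closed right ideal `closure (t(X) B)`. -/
def repIdeal (t : W.X → B) : Submodule ℂ B :=
  (Submodule.span ℂ {b : B | ∃ x c, b = t x * c}).topologicalClosure

theorem isClosed_repIdeal : IsClosed (repIdeal t : Set B) :=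
  Submodule.isClosed_topologicalClosure _

theorem mul_mem_repIdeal (x : W.X) (c : B) : t x * c ∈ repIdeal t :=
  Submodule.le_topologicalClosure _ (Submodule.subset_span ⟨x, c, rfl⟩)

theorem repIdeal_induction {P : B → Prop} (hc : IsClosed {b | P b})
    (hmem : ∀ x c, P (t x * c)) (hzero : P 0)
    (hadd : ∀ x y, P x → P y → P (x + y)) (hsmul : ∀ (c : ℂ) x, P x → P (c • x))
    {b : B} (hb : b ∈ repIdeal t) : P b := by
  have hb : b ∈ closure (Submodule.span ℂ {b : B | ∃ x c, b = t x * c} : Set B) := hb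
  refine (closure_minimal (fun y hy => ?_) hc) hb
  refine Submodule.span_induction (p := fun z _ => P z) ?_ hzero
    (fun _ _ _ _ => hadd _ _) (fun _ _ _ => hsmul _ _) hy
  rintro _ ⟨x, c, rfl⟩
  exact hmem x c

theorem mem_of_mem_repIdeal {M : Submodule ℂ B} (hM : IsClosed (M : Set B))
    {f : B → B} (hf : IsCLMap f) (h : ∀ x c, f (t x * c) ∈ M) {b : B} (hb : b ∈ repIdeal t) :
    f b ∈ M :=
  repIdeal_induction (P := fun b => f b ∈ M) (hM.preimage hf.cont) h
    (by rw [hf.map_zero]; exact M.zero_mem)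
    (fun x y hx hy => by rw [hf.map_add]; exact M.add_mem hx hy)
    (fun c x hx => by rw [hf.map_smul]; exact M.smul_mem c hx) hb

theorem repIdeal_mul_mem {b : B} (hb : b ∈ repIdeal t) (c : B) : b * c ∈ repIdeal t :=
  mem_of_mem_repIdeal isClosed_repIdeal (isCLMap_mul_right c)
    (fun x d => by rw [mul_assoc]; exact mul_mem_repIdeal x _) hb

theorem IsRep.mem_repIdeal (h : IsRep W π t) (x : W.X) : t x ∈ repIdeal t := by
  refine dense_span_induction W.dense_span_ract (P := fun x => t x ∈ repIdeal t)
    (isClosed_repIdeal.preimage h.isCLMap.cont) ?_ ?_ ?_ ?_ x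
  · rintro _ ⟨x, a, rfl⟩
    rw [h.ract]
    exact mul_mem_repIdeal x _
  · rw [h.isCLMap.map_zero]
    exact zero_mem _
  · intro x y hx hy
    rw [h.t_add]
    exact add_mem hx hy
  · intro c x hx
    rw [h.t_smul]
    exact Submodule.smul_mem _ c hx

/-- An operator in `B` which acts on `t(X)` through an adjointable operator `Δ` has norm at most
`‖Δ‖` on the closed right ideal generated by `t(X)`. -/
theorem IsRep.norm_mul_le_of_mem_repIdeal (hW : W.Tame) (h : IsRep W π t) {D : B}
    {Δ Δ' : W.X → W.X} {δ : ℝ} (hδ : 0 ≤ δ)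
    (hadj : ∀ x y, W.inner (Δ x) y = W.inner x (Δ' y))
    (hD : ∀ z, D * t z = t (Δ z)) (hD' : ∀ z, star D * t z = t (Δ' z))
    (hΔ : ∀ z, ‖Δ z‖ ≤ δ * ‖z‖) {c : B} (hc : c ∈ repIdeal t) : ‖D * c‖ ≤ δ * ‖c‖ := by
  have hΔ' : ∀ z, ‖Δ' z‖ ≤ δ * ‖z‖ := by
    intro z
    have h1 : ‖Δ' z‖ ^ 2 ≤ (δ * ‖Δ' z‖) * ‖z‖ := by
      rw [W.norm_eq, ← hadj]
      exact (hW.inner_le _ _).trans (by gcongr; exact hΔ _)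
    by_contra! hlt
    have : 0 ≤ δ * ‖z‖ := by positivity
    nlinarith
  have hF : ∀ (k : ℕ) z, ‖(fun z => Δ' (Δ z))^[k] z‖ ≤ (δ ^ 2) ^ k * ‖z‖ := by
    intro k
    induction k with
    | zero => simp
    | succ k ih =>
      intro z
      rw [Function.iterate_succ_apply, pow_succ]
      refine (ih _).trans ?_
      rw [mul_assoc]
      gcongr
      calc ‖Δ' (Δ z)‖ ≤ δ * (δ * ‖z‖) := (hΔ' _).trans (by gcongr; exact hΔ _)
        _ = δ ^ 2 * ‖z‖ := by ring
  let e : ℕ → B := fun n => Nat.rec (star D * D) (fun _ E => E * E) n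
  have he0 : e 0 = star D * D := rfl
  have hes : ∀ j, e (j + 1) = e j * e j := fun _ => rfl
  have hsa : ∀ j, star (e j) = e j := by
    intro j
    induction j with
    | zero => simp [he0]
    | succ j ih => rw [hes, star_mul, ih]
  have het : ∀ j z, e j * t z = t ((fun z => Δ' (Δ z))^[2 ^ j] z) := by
    intro j
    induction j with
    | zero => intro z; simp [he0, mul_assoc, hD, hD']
    | succ j ih =>
      intro z
      rw [hes, mul_assoc, ih, ih, pow_succ, mul_two, Function.iterate_add_apply]
  have hspan : ∀ c ∈ Submodule.span ℂ {b : B | ∃ x c, b = t x * c},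
      ∃ C : ℝ, ∀ j, ‖e j * c‖ ≤ C * (δ ^ 2) ^ (2 ^ j) := by
    intro c hc
    refine Submodule.span_induction
      (p := fun c _ => ∃ C : ℝ, ∀ j, ‖e j * c‖ ≤ C * (δ ^ 2) ^ (2 ^ j))
      ?_ ⟨0, by simp⟩ ?_ ?_ hc
    · rintro _ ⟨x, d, rfl⟩
      refine ⟨‖x‖ * ‖d‖, fun j => ?_⟩
      rw [← mul_assoc, het]
      refine (norm_mul_le _ _).trans ?_
      calc _ ≤ ((δ ^ 2) ^ (2 ^ j) * ‖x‖) * ‖d‖ := by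
            gcongr
            exact (h.norm_le _).trans (hF _ _)
        _ = _ := by ring
    · rintro x y _ _ ⟨C₁, h₁⟩ ⟨C₂, h₂⟩
      refine ⟨C₁ + C₂, fun j => ?_⟩
      rw [mul_add, add_mul]
      exact (norm_add_le _ _).trans (add_le_add (h₁ j) (h₂ j))
    · rintro a x _ ⟨C, hC⟩
      refine ⟨‖a‖ * C, fun j => ?_⟩
      rw [mul_smul_comm, norm_smul, mul_assoc]
      gcongr
      exact hC j
  have hsq : ∀ j c, ‖e j * c‖ ^ 2 ≤ ‖c‖ * ‖e (j + 1) * c‖ := by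
    intro j c
    rw [sq, ← CStarRing.norm_star_mul_self, star_mul, hsa, mul_assoc, ← mul_assoc (e j), ← hes,
      ← norm_star c]
    exact norm_mul_le _ _
  have hmain : ∀ c ∈ Submodule.span ℂ {b : B | ∃ x c, b = t x * c}, ‖D * c‖ ≤ δ * ‖c‖ := by
    intro c hc
    obtain ⟨C, hC⟩ := hspan c hc
    have h0 := le_mul_of_sq_le_mul_succ (b := fun j => ‖e j * c‖) (fun _ => norm_nonneg _)
      (norm_nonneg c) (sq_nonneg δ) (fun j => hsq j c) hC
    have h1 : ‖D * c‖ ^ 2 ≤ (δ * ‖c‖) ^ 2 := by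
      rw [sq, ← CStarRing.norm_star_mul_self, star_mul, mul_assoc, ← mul_assoc _ D, ← he0]
      refine (norm_mul_le _ _).trans ?_
      rw [norm_star]
      have := mul_le_mul_of_nonneg_left h0 (norm_nonneg c)
      linarith
    exact (sq_le_sq₀ (norm_nonneg _) (by positivity)).1 h1
  have hc : c ∈ closure (Submodule.span ℂ {b : B | ∃ x c, b = t x * c} : Set B) := hc
  exact closure_minimal (s := (Submodule.span ℂ {b : B | ∃ x c, b = t x * c} : Set B))
    (t := {c | ‖D * c‖ ≤ δ * ‖c‖}) hmain
    (isClosed_le (by fun_prop) (by fun_prop)) hc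

end Ideal

section Covariance

variable {W : Corr A} {π : A → B} {t : W.X → B}

theorem Corr.rankOne_adjoint (W : Corr A) (x y z w : W.X) :
    W.inner (W.rankOne x y z) w = W.inner z (W.rankOne y x w) := by
  rw [W.rankOne_apply, W.rankOne_apply, W.inner_ract_left, W.inner_ract_right, W.inner_star]

theorem IsRep.mul_star_mul (h : IsRep W π t) (x y z : W.X) :
    t x * star (t y) * t z = t (W.rankOne x y z) := by
  rw [W.rankOne_apply, h.ract, mul_assoc, h.inner]

theorem IsRep.sum_sub_mul (h : IsRep W π t) {N : ℕ} (x y : Fin N → W.X) (a : A) (z : W.X) :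
    (∑ r, t (x r) * star (t (y r)) - π a) * t z =
      t ((∑ r, W.rankOne (x r) (y r) - W.lactL a) z) := by
  have hs := h.isCLMap
  have hsum : t (∑ r, W.rankOne (x r) (y r) z) = ∑ r, t (W.rankOne (x r) (y r) z) :=
    map_sum (AddMonoidHom.mk' t h.t_add) _ _
  have hsub : ∀ u v, t (u - v) = t u - t v := map_sub (AddMonoidHom.mk' t h.t_add)
  simp only [sub_mul, Finset.sum_mul, h.mul_star_mul, sub_apply,
    sum_apply, hsub, hsum, h.lact]

/-- The estimate `‖D c‖ ≤ ‖Δ‖ ‖c‖` for `D = ∑ t(x)t(y)* - π(a)`, `Δ = ∑ θ_{x,y} - φ(a)`. -/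
theorem IsRep.norm_sum_sub_mul_le (hW : W.Tame) (h : IsRep W π t) {N : ℕ}
    (x y : Fin N → W.X) (a : A) {c : B} (hc : c ∈ repIdeal t) :
    ‖(∑ r, t (x r) * star (t (y r)) - π a) * c‖ ≤
      ‖∑ r, W.rankOne (x r) (y r) - W.lactL a‖ * ‖c‖ := by
  refine h.norm_mul_le_of_mem_repIdeal hW (norm_nonneg _)
    (Δ := fun z => (∑ r, W.rankOne (x r) (y r) - W.lactL a) z)
    (Δ' := fun z => (∑ r, W.rankOne (y r) (x r) - W.lactL (star a)) z) ?_
    (h.sum_sub_mul x y a) ?_ (fun z => ContinuousLinearMap.le_opNorm _ z) hc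
  · intro u v
    simp only [sub_apply, sum_apply, W.inner_sub_left,
      W.inner_sub_right, W.inner_sum_left, W.inner_sum_right, W.rankOne_adjoint, W.lact_adjoint]
  · intro z
    rw [← h.sum_sub_mul]
    simp [star_sum, h.hom.map_star]

theorem IsRep.cpCov_of_mem (hW : W.Tame) (h : IsRep W π t) (hm : ∀ a, π a ∈ repIdeal t) :
    CPCov W π t := by
  intro a N x y hlim
  rw [tendsto_iff_norm_sub_tendsto_zero] at hlim ⊢
  refine squeeze_zero (fun _ => norm_nonneg _) (fun n => ?_) hlim
  have hmem : star (∑ r, t (x n r) * star (t (y n r)) - π a) ∈ repIdeal t := by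
    simp only [star_sub, star_sum, star_mul, star_star, ← h.hom.map_star]
    exact sub_mem (sum_mem fun r _ => mul_mem_repIdeal _ _) (hm _)
  have h1 := h.norm_sum_sub_mul_le hW (x n) (y n) a hmem
  rw [CStarRing.norm_self_mul_star, norm_star] at h1
  by_contra! hlt
  nlinarith [norm_nonneg (∑ r, W.rankOne (x n r) (y n r) - W.lactL a)]

theorem Corr.exists_sum_rankOne {T : W.X →L[ℂ] W.X}
    (hT : T ∈ Submodule.span ℂ {T : W.X →L[ℂ] W.X | ∃ x y, T = W.rankOne x y}) :
    ∃ (N : ℕ) (x y : Fin N → W.X), T = ∑ r, W.rankOne (x r) (y r) := by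
  obtain ⟨N, c, g, rfl⟩ := Submodule.mem_span_set'.1 hT
  choose x y hxy using fun i => (g i).2
  refine ⟨N, fun i => c i • x i, y, Finset.sum_congr rfl fun i _ => ?_⟩
  ext z
  rw [hxy, smul_apply, W.rankOne_apply, W.rankOne_apply, W.ract_smul]

theorem Corr.Regular.exists_tendsto (hW : W.Regular) (a : A) :
    ∃ (N : ℕ → ℕ) (x y : ∀ n, Fin (N n) → W.X),
      Tendsto (fun n => ∑ r, W.rankOne (x n r) (y n r)) atTop (𝓝 (W.lactL a)) := by
  obtain ⟨T, hT, hlim⟩ := mem_closure_iff_seq_limit.1 (hW.2 a)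
  choose N x y hxy using fun n => W.exists_sum_rankOne (hT n)
  exact ⟨N, x, y, by simpa only [← hxy] using hlim⟩

theorem CPCov.mem_repIdeal (hcov : CPCov W π t) (hW : W.Regular) (a : A) : π a ∈ repIdeal t := by
  obtain ⟨N, x, y, hlim⟩ := hW.exists_tendsto a
  refine isClosed_repIdeal.mem_of_tendsto (hcov a N x y hlim) (.of_forall fun n => ?_)
  exact sum_mem fun r _ => mul_mem_repIdeal _ _

/-- Covariance passes from `Z` to `W` when `W` is represented inside a faithful covariant
representation of `Z`, and generates it as a right ideal. -/
theorem CPCov.of_factor {C : Type u} [NonUnitalCStarAlgebra C] {Z : Corr C} {ρ : C → B}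
    {s : Z.X → B} {σ : A → C} {j : W.X → Z.X} (hcov : CPCov Z ρ s) (hs : IsRep Z ρ s)
    (hρ : Function.Injective ρ) (hW : W.Tame) (h : IsRep W π t) (hσ : ∀ a, ρ (σ a) = π a)
    (hj : ∀ x, s (j x) = t x) (hmem : ∀ z, s z ∈ repIdeal t) : CPCov W π t := by
  intro a N x y hlim
  rw [← hσ a]
  simp only [← hj]
  refine hcov (σ a) N (fun n r => j (x n r)) (fun n r => j (y n r)) ?_
  rw [tendsto_iff_norm_sub_tendsto_zero] at hlim ⊢
  refine squeeze_zero (fun _ => norm_nonneg _) (fun n => ?_) hlim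
  refine ContinuousLinearMap.opNorm_le_bound _ (norm_nonneg _) fun z => ?_
  rw [← hs.norm_eq hρ, ← hs.sum_sub_mul, ← hs.norm_eq hρ z]
  simp only [hj, hσ]
  exact h.norm_sum_sub_mul_le hW _ _ a (hmem z)

end Covariance

section TensorRep

variable {W V T : Corr A} {m : W.X → V.X → T.X} {π : A → B}

/-- A family in a C*-algebra with the Gram matrix of a total family of a Hilbert module
extends to an isometric-type map of the module. -/
theorem Corr.exists_map_of_total (hW : W.Tame) (hπ : IsStarHom π) {ι : Type*} (v : ι → W.X)
    (w : ι → B) (hv : closure (Submodule.span ℂ (Set.range v) : Set W.X) = Set.univ)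
    (hvw : ∀ i k, star (w i) * w k = π (W.inner (v i) (v k))) :
    ∃ f : W.X → B, IsCLMap f ∧ (∀ i, f (v i) = w i) ∧
      ∀ x y, star (f x) * f y = π (W.inner x y) := by
  obtain ⟨f, hf, hfv⟩ := exists_isCLMap_of_total v w hv (fun c => by
    have key : star (Finsupp.linearCombination ℂ w c) * Finsupp.linearCombination ℂ w c =
        π (W.inner (Finsupp.linearCombination ℂ v c) (Finsupp.linearCombination ℂ v c)) := by
      have hsum : ∀ (g : ι → A), π (∑ i ∈ c.support, g i) = ∑ i ∈ c.support, π (g i) :=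
        fun g => map_sum hπ.toHom g _
      simp only [Finsupp.linearCombination_apply, Finsupp.sum, W.inner_sum_left,
        W.inner_sum_right, W.inner_smul_left, W.inner_smul_right, hsum, hπ.map_smul, ← hvw,
        star_sum, star_smul, Finset.sum_mul, Finset.mul_sum, smul_mul_assoc, mul_smul_comm,
        Finset.smul_sum]
      rw [Finset.sum_comm]
      exact Finset.sum_congr rfl fun i _ => Finset.sum_congr rfl fun k _ => smul_comm _ _ _
    have h1 : ‖Finsupp.linearCombination ℂ w c‖ ^ 2 ≤ ‖Finsupp.linearCombination ℂ v c‖ ^ 2 := by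
      rw [W.norm_eq, sq, ← CStarRing.norm_star_mul_self, key]
      exact hπ.norm_le _
    exact (sq_le_sq₀ (norm_nonneg _) (norm_nonneg _)).1 h1)
  refine ⟨f, hf, hfv, ?_⟩
  have step : ∀ i y, star (f (v i)) * f y = π (W.inner (v i) y) := fun i =>
    IsCLMap.eq_of_dense hv ((isCLMap_mul_left _).comp hf) (hπ.isCLMap.comp (hW.inner_right _))
      (by rintro _ ⟨k, rfl⟩; rw [hfv, hfv, hvw])
  intro x y
  have h2 : ∀ x, star (f y) * f x = π (W.inner y x) :=
    IsCLMap.eq_of_dense hv ((isCLMap_mul_left _).comp hf) (hπ.isCLMap.comp (hW.inner_right _)) (by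
      rintro _ ⟨k, rfl⟩
      rw [← W.inner_star, hπ.map_star, ← step, star_mul, star_star])
  rw [← W.inner_star, hπ.map_star, ← h2, star_mul, star_star]

namespace IsTensor

theorem norm_le (hT : IsTensor W V T m) (hV : V.Tame) (x : W.X) (y : V.X) :
    ‖m x y‖ ≤ ‖x‖ * ‖y‖ := by
  have h1 : ‖m x y‖ ^ 2 ≤ (‖x‖ * ‖y‖) ^ 2 := by
    rw [T.norm_eq, hT.inner]
    refine (hV.inner_le _ _).trans ?_
    calc _ ≤ ‖y‖ * (‖W.inner x x‖ * ‖y‖) := by gcongr; exact hV.lact_le _ _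
      _ = _ := by rw [← W.norm_eq]; ring
  exact (sq_le_sq₀ (norm_nonneg _) (by positivity)).1 h1

theorem isCLMap_right (hT : IsTensor W V T m) (hV : V.Tame) (x : W.X) : IsCLMap (m x) :=
  .of_bound (hT.add_right x) (fun c y => hT.smul_right c x y) ‖x‖ (hT.norm_le hV x)

theorem isCLMap_left (hT : IsTensor W V T m) (hV : V.Tame) (y : V.X) : IsCLMap fun x => m x y :=
  .of_bound (fun x x' => hT.add_left x x' y) (fun c x => hT.smul_left c x y) ‖y‖
    fun x => by rw [mul_comm ‖y‖]; exact hT.norm_le hV x y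

theorem eq_of_eq (hT : IsTensor W V T m) {F : Type u} [NormedAddCommGroup F] [NormedSpace ℂ F]
    {f g : T.X → F} (hf : IsCLMap f) (hg : IsCLMap g) (h : ∀ x y, f (m x y) = g (m x y))
    (z : T.X) : f z = g z :=
  hf.eq_of_dense hT.dense hg (by rintro _ ⟨x, y, rfl⟩; exact h x y) z

/-- The tensor product of two representations. -/
theorem exists_isRep (hT : IsTensor W V T m) (htT : T.Tame) {t : W.X → B} {s : V.X → B}
    (ht : IsRep W π t) (hs : IsRep V π s) :
    ∃ f : T.X → B, IsRep T π f ∧ ∀ x y, f (m x y) = t x * s y := by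
  obtain ⟨f, hf, hfm, hin⟩ := T.exists_map_of_total htT ht.hom
    (fun p : W.X × V.X => m p.1 p.2) (fun p => t p.1 * s p.2) (by
      convert hT.dense using 4
      ext z
      simp [eq_comm]) (fun p q => by
      rw [hT.inner, star_mul, mul_assoc, ← mul_assoc (star (t p.1)), ht.inner, ← hs.lact,
        hs.inner])
  refine ⟨f, ⟨ht.hom, hf.map_add, hf.map_smul, fun a => ?_, fun x a => ?_, hin⟩,
    fun x y => hfm (x, y)⟩
  · refine hT.eq_of_eq (hf.comp (T.lactL a).isCLMap) ((isCLMap_mul_left _).comp hf) fun x y => ?_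
    rw [hT.lact, hfm (W.lactL a x, y), hfm (x, y), ht.lact, mul_assoc]
  · refine hT.eq_of_eq (hf.comp (htT.ract_left a)) ((isCLMap_mul_right _).comp hf)
      (fun x y => ?_) x
    rw [hT.ract, hfm (x, V.ract y a), hfm (x, y), hs.ract, mul_assoc]

theorem _root_.IsRep.mem_repIdeal_of_tensor {t : W.X → B} {s : V.X → B} {f : T.X → B}
    (ht : IsRep W π t) (hfm : ∀ x y, f (m x y) = t x * s y)
    (hmt : ∀ a, π a ∈ repIdeal t) (hms : ∀ a, π a ∈ repIdeal s) (a : A) : π a ∈ repIdeal f := by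
  have h1 : ∀ x, t x ∈ repIdeal f := by
    intro x
    refine dense_span_induction W.dense_span_ract (P := fun x => t x ∈ repIdeal f)
      (isClosed_repIdeal.preimage ht.isCLMap.cont) ?_ ?_ ?_ ?_ x
    · rintro _ ⟨x, a, rfl⟩
      rw [ht.ract]
      refine mem_of_mem_repIdeal isClosed_repIdeal (isCLMap_mul_left (t x)) (fun y c => ?_) (hms a)
      rw [← mul_assoc, ← hfm]
      exact mul_mem_repIdeal _ _
    · rw [ht.isCLMap.map_zero]
      exact zero_mem _
    · intro x y hx hy
      rw [ht.t_add]
      exact add_mem hx hy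
    · intro c x hx
      rw [ht.t_smul]
      exact Submodule.smul_mem _ c hx
  exact mem_of_mem_repIdeal isClosed_repIdeal IsCLMap.id
    (fun x c => repIdeal_mul_mem (h1 x) c) (hmt a)

end IsTensor

end TensorRep

namespace PSys

variable {k : ℕ} (Xs : PSys A k)

/-- Multiplication of a product system, with values in any fiber of the correct degree. -/
def mulTo {s t r : Fin k → ℕ} (h : s + t = r) (x : (Xs.fib s).X) (y : (Xs.fib t).X) :
    (Xs.fib r).X :=
  h ▸ Xs.mul s t x y

theorem mulTo_heq {s t r : Fin k → ℕ} (h : s + t = r) (x : (Xs.fib s).X) (y : (Xs.fib t).X) :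
    HEq (Xs.mulTo h x y) (Xs.mul s t x y) := by
  subst h; rfl

theorem isTensor_mulTo {s t r : Fin k → ℕ} (h : s + t = r) :
    IsTensor (Xs.fib s) (Xs.fib t) (Xs.fib r) (Xs.mulTo h) := by
  subst h; exact Xs.isTensor s t

theorem mulTo_assoc {s t w p q r : Fin k → ℕ} (h₁ : s + t = p) (h₂ : p + w = r)
    (h₃ : t + w = q) (h₄ : s + q = r) (x : (Xs.fib s).X) (y : (Xs.fib t).X) (z : (Xs.fib w).X) :
    Xs.mulTo h₂ (Xs.mulTo h₁ x y) z = Xs.mulTo h₄ x (Xs.mulTo h₃ y z) := by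
  subst h₁ h₃ h₂
  exact eq_of_heq ((Xs.assoc s t w x y z).trans (Xs.mulTo_heq h₄ x _).symm)

theorem mulTo_unit_left {s : Fin k → ℕ} (h : 0 + s = s) (a : A) (x : (Xs.fib s).X) :
    Xs.mulTo h (Xs.unit a) x = (Xs.fib s).lactL a x :=
  eq_of_heq ((Xs.mulTo_heq h _ _).trans (Xs.unit_mul_left s a x))

theorem mulTo_unit_right {s : Fin k → ℕ} (h : s + 0 = s) (x : (Xs.fib s).X) (a : A) :
    Xs.mulTo h x (Xs.unit a) = (Xs.fib s).ract x a :=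
  eq_of_heq ((Xs.mulTo_heq h _ _).trans (Xs.unit_mul_right s x a))

end PSys

section Degrees

variable {k : ℕ}

theorem egen_add_ne_zero (i : Fin k) (s : Fin k → ℕ) : egen i + s ≠ 0 := fun h => by
  simpa [egen] using congrFun h i

theorem sum_egen_add (i : Fin k) (s : Fin k → ℕ) : ∑ l, (egen i + s) l = 1 + ∑ l, s l := by
  simp [egen, Finset.sum_add_distrib]

theorem exists_egen_add {s : Fin k → ℕ} {i : Fin k} (h : s i ≠ 0) : ∃ s', egen i + s' = s := by
  refine ⟨s - egen i, add_tsub_cancel_of_le fun l => ?_⟩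
  rcases eq_or_ne l i with rfl | hl
  · simpa [egen] using Nat.one_le_iff_ne_zero.2 h
  · simp [egen, hl]

theorem exists_egen_add_of_ne_zero {s : Fin k → ℕ} (h : s ≠ 0) : ∃ i s', egen i + s' = s := by
  obtain ⟨i, hi⟩ := Function.ne_iff.1 h
  exact ⟨i, exists_egen_add hi⟩

/-- Induction on the degree, adding one generator at a time. -/
theorem degree_induction {P : (Fin k → ℕ) → Prop} (zero : P 0)
    (step : ∀ i s, P s → P (egen i + s)) (s : Fin k → ℕ) : P s := by
  induction hN : ∑ l, s l generalizing s with
  | zero =>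
    have : s = 0 := funext fun l => by
      simpa using (Finset.sum_eq_zero_iff.1 hN) l (Finset.mem_univ l)
    exact this ▸ zero
  | succ N ih =>
    have hs : s ≠ 0 := by rintro rfl; simp at hN
    obtain ⟨i, s', rfl⟩ := exists_egen_add_of_ne_zero hs
    rw [sum_egen_add] at hN
    exact step i s' (ih s' (by omega))

end Degrees

/-- Representations of the generating fibers of a product system, satisfying the commutation
relations needed to extend them to the whole product system. -/
structure GenRep {k : ℕ} (Xs : PSys A k) (B : Type u) [NonUnitalCStarAlgebra B] : Type u where
  π : A → B
  τ : ∀ i, (Xs.fib (egen i)).X → B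
  isRep : ∀ i, IsRep (Xs.fib (egen i)) π (τ i)
  hom : IsStarHom π
  comm : ∀ i j, i ≠ j → ∀ (r : Fin k → ℕ) (hij : egen i + egen j = r) (hji : egen j + egen i = r),
    ∃ N : (Xs.fib r).X → B, IsCLMap N ∧ (∀ x y, N (Xs.mulTo hij x y) = τ i x * τ j y) ∧
      ∀ y x, N (Xs.mulTo hji y x) = τ j y * τ i x

namespace GenRep

variable {k : ℕ} {Xs : PSys A k} (ρ : GenRep Xs B)

open Classical in
/-- The extension of representations of the generating fibers to all fibers. -/
def ext (s : Fin k → ℕ) : (Xs.fib s).X → B :=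
  if h : s = 0 then fun x => ρ.π ((Equiv.ofBijective _ Xs.unit_bij).symm (h ▸ x))
  else Classical.epsilon fun f => IsRep (Xs.fib s) ρ.π f ∧
    ∀ i s' (h : egen i + s' = s) x y, f (Xs.mulTo h x y) = ρ.τ i x * ext s' y
termination_by ∑ l, s l
decreasing_by rw [← h, sum_egen_add]; omega

theorem ext_zero (a : A) : ρ.ext 0 (Xs.unit a) = ρ.π a := by
  rw [ext, dif_pos rfl]
  congr 1
  exact (Equiv.ofBijective _ Xs.unit_bij).symm_apply_apply a

theorem isRep_ext_zero : IsRep (Xs.fib 0) ρ.π (ρ.ext 0) := by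
  have hu := Xs.unit_bij.2
  refine ⟨ρ.hom, ?_, ?_, ?_, ?_, ?_⟩
  · intro x y
    obtain ⟨a, rfl⟩ := hu x
    obtain ⟨b, rfl⟩ := hu y
    simp only [← Xs.unit_add, ext_zero, ρ.hom.map_add]
  · intro c x
    obtain ⟨a, rfl⟩ := hu x
    simp only [← Xs.unit_smul, ext_zero, ρ.hom.map_smul]
  · intro a x
    obtain ⟨b, rfl⟩ := hu x
    simp only [Xs.unit_lact, ext_zero, ρ.hom.map_mul]
  · intro x a
    obtain ⟨b, rfl⟩ := hu x
    simp only [Xs.unit_ract, ext_zero, ρ.hom.map_mul]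
  · intro x y
    obtain ⟨a, rfl⟩ := hu x
    obtain ⟨b, rfl⟩ := hu y
    simp only [Xs.unit_inner, ext_zero, ρ.hom.map_mul, ρ.hom.map_star]

theorem ext_spec (hX : ∀ s, (Xs.fib s).Tame) (s : Fin k → ℕ) : IsRep (Xs.fib s) ρ.π (ρ.ext s) ∧
    ∀ i s' (h : egen i + s' = s) x y, ρ.ext s (Xs.mulTo h x y) = ρ.τ i x * ρ.ext s' y := by
  induction hN : ∑ l, s l using Nat.strong_induction_on generalizing s with
  | _ N ih =>
  subst hN
  by_cases hs : s = 0
  · subst hs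
    exact ⟨ρ.isRep_ext_zero, fun i s' h => absurd h (egen_add_ne_zero i s')⟩
  suffices h : ∃ f, IsRep (Xs.fib s) ρ.π f ∧
      ∀ i s' (h : egen i + s' = s) x y, f (Xs.mulTo h x y) = ρ.τ i x * ρ.ext s' y by
    rw [ext, dif_neg hs]
    exact Classical.epsilon_spec h
  replace ih : ∀ i s', egen i + s' = s → _ := fun i s' h =>
    ih (∑ l, s' l) (by rw [← h, sum_egen_add]; omega) s' rfl
  obtain ⟨i₀, s₀, h₀⟩ := exists_egen_add_of_ne_zero hs
  obtain ⟨f, hf, hfm⟩ :=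
    (Xs.isTensor_mulTo h₀).exists_isRep (hX s) (ρ.isRep i₀) (ih i₀ s₀ h₀).1
  refine ⟨f, hf, fun i s' h x y => ?_⟩
  rcases eq_or_ne i i₀ with rfl | hi
  · obtain rfl : s' = s₀ := add_left_cancel (h.trans h₀.symm)
    exact hfm x y
  obtain ⟨s'', h₁⟩ : ∃ s'', egen i₀ + s'' = s' := by
    refine exists_egen_add fun h2 => ?_
    have := congrFun (h.trans h₀.symm) i₀
    simp [egen, h2, hi.symm] at this
    omega
  have h₂ : egen i + s'' = s₀ := add_left_cancel (a := egen i₀) <| by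
    rw [h₀, ← h, ← h₁, add_left_comm]
  have hA : egen i + egen i₀ + s'' = s := by rw [add_assoc, h₁, h]
  have hji : egen i₀ + egen i = egen i + egen i₀ := add_comm _ _
  obtain ⟨N, hN, hN₁, hN₂⟩ := ρ.comm i i₀ hi _ rfl hji
  have key : ∀ w v, f (Xs.mulTo hA w v) = N w * ρ.ext s'' v := by
    intro w v
    refine (Xs.isTensor_mulTo hji).eq_of_eq
      (hf.isCLMap.comp ((Xs.isTensor_mulTo hA).isCLMap_left (hX _) v))
      ((isCLMap_mul_right _).comp hN) (fun u x => ?_) w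
    rw [Xs.mulTo_assoc hji hA h₂ h₀, hfm, (ih i₀ s₀ h₀).2 i s'' h₂, hN₂, mul_assoc]
  refine (Xs.isTensor_mulTo h₁).eq_of_eq
      (hf.isCLMap.comp ((Xs.isTensor_mulTo h).isCLMap_right (hX _) x))
      ((isCLMap_mul_left _).comp (ih i s' h).1.isCLMap) (fun u v => ?_) y
  rw [← Xs.mulTo_assoc rfl hA h₁ h, key, hN₁, (ih i s' h).2 i₀ s'' h₁, mul_assoc]

theorem ext_egen (hX : ∀ s, (Xs.fib s).Tame) (i : Fin k) (x : (Xs.fib (egen i)).X) :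
    ρ.ext (egen i) x = ρ.τ i x := by
  refine (ρ.ext_spec hX _).1.isCLMap.eq_of_dense (Xs.fib (egen i)).dense_span_ract
    (ρ.isRep i).isCLMap ?_ x
  rintro _ ⟨x, a, rfl⟩
  rw [← Xs.mulTo_unit_right (add_zero _), (ρ.ext_spec hX _).2, ext_zero, Xs.mulTo_unit_right,
    (ρ.isRep i).ract]

theorem ext_mul (hX : ∀ s, (Xs.fib s).Tame) (s t r : Fin k → ℕ) (h : s + t = r)
    (x : (Xs.fib s).X) (y : (Xs.fib t).X) :
    ρ.ext s x * ρ.ext t y = ρ.ext r (Xs.mulTo h x y) := by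
  induction s using degree_induction generalizing t r with
  | zero =>
    obtain rfl : t = r := by rw [← h, zero_add]
    obtain ⟨a, rfl⟩ := Xs.unit_bij.2 x
    rw [ext_zero, Xs.mulTo_unit_left, (ρ.ext_spec hX _).1.lact]
  | step i s ih =>
    refine (Xs.isTensor_mulTo rfl).eq_of_eq
      ((isCLMap_mul_right _).comp (ρ.ext_spec hX _).1.isCLMap)
      ((ρ.ext_spec hX _).1.isCLMap.comp ((Xs.isTensor_mulTo h).isCLMap_left (hX _) y))
      (fun u v => ?_) x
    have h' : egen i + (s + t) = r := by rw [← h, add_assoc]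
    rw [Xs.mulTo_assoc rfl h rfl h', (ρ.ext_spec hX _).2, (ρ.ext_spec hX _).2, ← ih t _ rfl,
      mul_assoc]

/-- The representation of a product system determined by representations of the generating
fibers. -/
def toPSRep (hX : ∀ s, (Xs.fib s).Tame) : PSRep Xs B where
  π := ρ.π
  ψ := ρ.ext
  isRep s := (ρ.ext_spec hX s).1
  ψ_zero := ρ.ext_zero
  mul s t x y := ρ.ext_mul hX s t _ rfl x y

theorem cpCov_toPSRep (hX : ∀ s, (Xs.fib s).Tame)
    (hτ : ∀ i a, ρ.π a ∈ repIdeal (ρ.τ i)) : PSCPCov (ρ.toPSRep hX) := by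
  intro s
  refine (ρ.ext_spec hX s).1.cpCov_of_mem (hX s) ?_
  induction s using degree_induction with
  | zero =>
    intro a
    have h := ρ.isRep_ext_zero.mem_repIdeal (Xs.unit a)
    rwa [ext_zero] at h
  | step i s ih =>
    exact (ρ.isRep i).mem_repIdeal_of_tensor ((ρ.ext_spec hX _).2 i s rfl) (hτ i) ih

end GenRep

namespace CorrIso

variable {W Z : Corr A} (e : CorrIso W Z)

theorem norm_map (x : W.X) : ‖e.toFun x‖ = ‖x‖ := by
  have h : ‖e.toFun x‖ ^ 2 = ‖x‖ ^ 2 := by rw [Z.norm_eq, e.map_inner, W.norm_eq]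
  exact (sq_eq_sq₀ (norm_nonneg _) (norm_nonneg _)).1 h

theorem isCLMap : IsCLMap e.toFun :=
  .of_bound e.map_add e.map_smul 1 fun x => by rw [e.norm_map, one_mul]

theorem injective : Function.Injective e.toFun := Function.LeftInverse.injective e.left_inv

/-- The inverse of an isomorphism of correspondences. -/
def symm : CorrIso Z W where
  toFun := e.invFun
  invFun := e.toFun
  left_inv := e.right_inv
  right_inv := e.left_inv
  map_add x y := e.injective (by simp only [e.map_add, e.right_inv])
  map_smul c x := e.injective (by simp only [e.map_smul, e.right_inv])
  map_inner x y := by rw [← e.map_inner, e.right_inv, e.right_inv]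
  map_ract x a := e.injective (by simp only [e.map_ract, e.right_inv])
  map_lact a x := e.injective (by simp only [e.map_lact, e.right_inv])

theorem isRep {π : A → B} {t : Z.X → B} (h : IsRep Z π t) :
    IsRep W π fun x => t (e.toFun x) where
  hom := h.hom
  t_add x y := by rw [e.map_add, h.t_add]
  t_smul c x := by rw [e.map_smul, h.t_smul]
  lact a x := by rw [e.map_lact, h.lact]
  ract x a := by rw [e.map_ract, h.ract]
  inner x y := by rw [h.inner, e.map_inner]

theorem repIdeal_comp {t : Z.X → B} : repIdeal (fun x => t (e.toFun x)) = repIdeal t := by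
  unfold repIdeal
  congr 2
  ext b
  constructor
  · rintro ⟨x, c, rfl⟩
    exact ⟨_, c, rfl⟩
  · rintro ⟨z, c, rfl⟩
    exact ⟨e.invFun z, c, by simp only [e.right_inv]⟩

end CorrIso

namespace GenSys

variable {k : ℕ} {G : GenSys A k}

/-- The maps `t i` and `t j` are compatible with the flip `θ i j`. -/
def FlipRel (G : GenSys A k) (i j : Fin k) (ti : (G.Y i).X → B) (tj : (G.Y j).X → B) : Prop :=
  ∃ (M : (G.T i j).X → B) (M' : (G.T j i).X → B), IsCLMap M ∧ IsCLMap M' ∧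
    (∀ x y, M (G.tmul i j x y) = ti x * tj y) ∧ (∀ y x, M' (G.tmul j i y x) = tj y * ti x) ∧
    ∀ z, M' ((G.θ i j).toFun z) = M z

theorem FlipRel.symm {i j : Fin k} {ti : (G.Y i).X → B} {tj : (G.Y j).X → B}
    (h : G.FlipRel i j ti tj) : G.FlipRel j i tj ti := by
  obtain ⟨M, M', hM, hM', h₁, h₂, h₃⟩ := h
  exact ⟨M', M, hM', hM, h₂, h₁, fun z => by rw [← h₃, G.θ_symm]⟩

theorem FlipRel.comp {C : Type u} [NonUnitalCStarAlgebra C] (f : B →⋆ₙₐ[ℂ] C) {i j : Fin k}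
    {ti : (G.Y i).X → B} {tj : (G.Y j).X → B} (h : G.FlipRel i j ti tj) :
    G.FlipRel i j (fun x => f (ti x)) (fun y => f (tj y)) := by
  obtain ⟨M, M', hM, hM', h₁, h₂, h₃⟩ := h
  exact ⟨_, _, f.isStarHom.isCLMap.comp hM, f.isStarHom.isCLMap.comp hM',
    fun x y => by rw [h₁, map_mul], fun y x => by rw [h₂, map_mul], fun z => by rw [h₃]⟩

end GenSys

namespace Generates

variable {k : ℕ} {G : GenSys A k} {Xs : PSys A k} (gen : Generates G Xs)

theorem isRep (r : PSRep Xs B) (i : Fin k) :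
    IsRep (G.Y i) r.π fun x => r.ψ (egen i) ((gen.ι i).toFun x) :=
  (gen.ι i).isRep (r.isRep _)

theorem flipRel (r : PSRep Xs B) (i j : Fin k) :
    G.FlipRel i j (fun x => r.ψ (egen i) ((gen.ι i).toFun x))
      (fun y => r.ψ (egen j) ((gen.ι j).toFun y)) := by
  have hcongr : ∀ {s s' : Fin k → ℕ} (_ : s = s') {x : (Xs.fib s).X} {x' : (Xs.fib s').X},
      HEq x x' → r.ψ s x = r.ψ s' x' := by
    rintro s _ rfl x x' h
    rw [eq_of_heq h]
  exact ⟨_, _, ((gen.κ i j).isRep (r.isRep _)).isCLMap, ((gen.κ j i).isRep (r.isRep _)).isCLMap,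
    fun x y => by rw [gen.κ_mul, r.mul], fun y x => by rw [gen.κ_mul, r.mul],
    fun z => hcongr (add_comm _ _) (gen.θ_compat i j z)⟩

/-- Representations of a generating system, as representations of the generating fibers of the
product system it generates. -/
def genRep {π : A → B} (hπ : IsStarHom π) (t : ∀ i, (G.Y i).X → B)
    (ht : ∀ i, IsRep (G.Y i) π (t i)) (hflip : ∀ i j, i ≠ j → G.FlipRel i j (t i) (t j)) :
    GenRep Xs B where
  π := π
  τ i x := t i ((gen.ι i).invFun x)
  isRep i := (gen.ι i).symm.isRep (ht i)
  hom := hπ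
  comm i j hij r h₁ h₂ := by
    obtain ⟨M, M', hM, -, hM₁, hM₂, hM₃⟩ := hflip i j hij
    subst h₁
    refine ⟨fun w => M ((gen.κ i j).invFun w), hM.comp (gen.κ i j).symm.isCLMap, ?_, ?_⟩
    · intro x y
      obtain ⟨x, rfl⟩ : ∃ x', (gen.ι i).toFun x' = x := ⟨_, (gen.ι i).right_inv x⟩
      obtain ⟨y, rfl⟩ : ∃ y', (gen.ι j).toFun y' = y := ⟨_, (gen.ι j).right_inv y⟩
      rw [(gen.ι i).left_inv, (gen.ι j).left_inv, ← hM₁, ← (gen.κ i j).left_inv (G.tmul i j x y),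
        gen.κ_mul]
      rfl
    · intro y x
      obtain ⟨x, rfl⟩ : ∃ x', (gen.ι i).toFun x' = x := ⟨_, (gen.ι i).right_inv x⟩
      obtain ⟨y, rfl⟩ : ∃ y', (gen.ι j).toFun y' = y := ⟨_, (gen.ι j).right_inv y⟩
      have h : Xs.mulTo h₂ ((gen.ι j).toFun y) ((gen.ι i).toFun x) =
          (gen.κ i j).toFun ((G.θ j i).toFun (G.tmul j i y x)) := by
        refine eq_of_heq ((Xs.mulTo_heq h₂ _ _).trans ?_)
        rw [← gen.κ_mul]
        exact (gen.θ_compat j i _).symm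
      rw [h]
      beta_reduce
      rw [(gen.κ i j).left_inv, ← hM₃, G.θ_symm, hM₂, (gen.ι i).left_inv, (gen.ι j).left_inv]

/-- The homomorphism out of the Cuntz–Pimsner algebra of a product system determined by
covariant representations of a generating system. -/
theorem exists_hom (C : PSCPAlg Xs) {π : A → B} (hπ : IsStarHom π) (t : ∀ i, (G.Y i).X → B)
    (ht : ∀ i, IsRep (G.Y i) π (t i)) (hflip : ∀ i j, i ≠ j → G.FlipRel i j (t i) (t j))
    (hmem : ∀ i a, π a ∈ repIdeal (t i)) :
    ∃ h : C.O →⋆ₙₐ[ℂ] B, (∀ a, h (C.rep.π a) = π a) ∧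
      ∀ i x, h (C.rep.ψ (egen i) ((gen.ι i).toFun x)) = t i x := by
  have hX : ∀ s, (Xs.fib s).Tame := fun s => (C.rep.isRep s).tame C.inj
  obtain ⟨h, ⟨h0, hψ⟩, -⟩ := C.universal B ((gen.genRep hπ t ht hflip).toPSRep hX)
    (GenRep.cpCov_toPSRep _ hX fun i a => by
      have := hmem i a
      rwa [← (gen.ι i).symm.repIdeal_comp] at this)
  refine ⟨h, h0, fun i x => (hψ _ _).trans ?_⟩
  refine (GenRep.ext_egen _ hX i _).trans ?_
  change t i ((gen.ι i).invFun ((gen.ι i).toFun x)) = t i x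
  rw [(gen.ι i).left_inv]

theorem induction (C : PSCPAlg Xs) {P : C.O → Prop} (hc : IsClosed {z | P z})
    (hπ : ∀ a, P (C.rep.π a)) (hψ : ∀ i x, P (C.rep.ψ (egen i) ((gen.ι i).toFun x)))
    (hadd : ∀ p q, P p → P q → P (p + q)) (hmul : ∀ p q, P p → P q → P (p * q))
    (hsmul : ∀ (c : ℂ) p, P p → P (c • p)) (hstar : ∀ p, P p → P (star p)) (z : C.O) : P z := by
  refine C.gen {z | P z} hc hπ (fun s => ?_) hadd hmul hsmul hstar z
  have h0 : P 0 := by simpa using hsmul 0 _ (hπ 0)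
  induction s using degree_induction with
  | zero =>
    intro x
    obtain ⟨a, rfl⟩ := Xs.unit_bij.2 x
    rw [C.rep.ψ_zero]
    exact hπ a
  | step i s ih =>
    refine dense_span_induction (Xs.isTensor (egen i) s).dense
      (P := fun x => P (C.rep.ψ (egen i + s) x)) (hc.preimage (C.rep.isRep _).isCLMap.cont)
      ?_ ?_ ?_ ?_
    · rintro _ ⟨x, y, rfl⟩
      rw [← C.rep.mul, ← (gen.ι i).right_inv x]
      exact hmul _ _ (hψ _ _) (ih y)
    · rwa [(C.rep.isRep _).isCLMap.map_zero]
    · intro x y hx hy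
      rw [(C.rep.isRep _).t_add]
      exact hadd _ _ hx hy
    · intro c x hx
      rw [(C.rep.isRep _).t_smul]
      exact hsmul c _ hx

theorem hom_ext (C : PSCPAlg Xs) {f g : C.O →⋆ₙₐ[ℂ] B} (h0 : ∀ a, f (C.rep.π a) = g (C.rep.π a))
    (h : ∀ i x, f (C.rep.ψ (egen i) ((gen.ι i).toFun x)) =
      g (C.rep.ψ (egen i) ((gen.ι i).toFun x))) (z : C.O) : f z = g z :=
  gen.induction C (isClosed_eq f.isStarHom.isCLMap.cont g.isStarHom.isCLMap.cont) h0 h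
    (fun p q hp hq => by rw [map_add, map_add, hp, hq])
    (fun p q hp hq => by rw [map_mul, map_mul, hp, hq])
    (fun c p hp => by rw [map_smul, map_smul, hp])
    (fun p hp => by rw [map_star, map_star, hp]) z

end Generates

theorem CPAlg.hom_ext {W : Corr A} (C : CPAlg W) {f g : C.O →⋆ₙₐ[ℂ] B}
    (h0 : ∀ a, f (C.π a) = g (C.π a)) (h : ∀ x, f (C.t x) = g (C.t x)) (z : C.O) : f z = g z :=
  C.gen {z | f z = g z} (isClosed_eq f.isStarHom.isCLMap.cont g.isStarHom.isCLMap.cont) h0 h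
    (fun p q (hp : f p = g p) (hq : f q = g q) => show f _ = g _ by
      rw [map_add, map_add, hp, hq])
    (fun p q (hp : f p = g p) (hq : f q = g q) => show f _ = g _ by
      rw [map_mul, map_mul, hp, hq])
    (fun c p (hp : f p = g p) => show f _ = g _ by rw [map_smul, map_smul, hp])
    (fun p (hp : f p = g p) => show f _ = g _ by rw [map_star, map_star, hp]) z

theorem Corr.eq_of_inner_eq (W : Corr A) {x y : W.X} (h : ∀ z, W.inner z x = W.inner z y) :
    x = y := by
  have h1 : ‖x - y‖ ^ 2 = 0 := by
    rw [W.norm_eq, W.inner_sub_right, h, sub_self, norm_zero]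
  simpa [sub_eq_zero] using h1

theorem Corr.lact_ract (W : Corr A) (a : A) (x : W.X) (b : A) :
    W.lactL a (W.ract x b) = W.ract (W.lactL a x) b := by
  have hadj : ∀ u v, W.inner u (W.lactL a v) = W.inner (W.lactL (star a) u) v := fun u v => by
    rw [W.lact_adjoint, star_star]
  exact W.eq_of_inner_eq fun z => by rw [hadj, W.inner_ract_right, W.inner_ract_right, hadj]

namespace MixedMod

variable {W : Corr A} {O : Type u} [NonUnitalCStarAlgebra O] {πA : A → O} {Z : Corr O}
  {m : W.X → O → Z.X}

theorem norm_le (h : MixedMod W O πA Z m) (hπ : IsStarHom πA) (x : W.X) (S : O) :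
    ‖m x S‖ ≤ ‖x‖ * ‖S‖ := by
  have h1 : ‖m x S‖ ^ 2 ≤ (‖x‖ * ‖S‖) ^ 2 := by
    rw [Z.norm_eq, h.inner]
    calc _ ≤ ‖S‖ * (‖W.inner x x‖ * ‖S‖) := by
          refine (norm_mul_le _ _).trans ?_
          rw [norm_star]
          gcongr
          refine (norm_mul_le _ _).trans ?_
          gcongr
          exact hπ.norm_le _
      _ = _ := by rw [← W.norm_eq]; ring
  exact (sq_le_sq₀ (norm_nonneg _) (by positivity)).1 h1

theorem isCLMap_left (h : MixedMod W O πA Z m) (hπ : IsStarHom πA) (S : O) :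
    IsCLMap fun x => m x S :=
  .of_bound (fun x x' => h.add_left x x' S) (fun c x => h.smul_left c x S) ‖S‖
    fun x => by rw [mul_comm ‖S‖]; exact h.norm_le hπ x S

theorem eq_of_eq (h : MixedMod W O πA Z m) {F : Type u} [NormedAddCommGroup F] [NormedSpace ℂ F]
    {f g : Z.X → F} (hf : IsCLMap f) (hg : IsCLMap g) (hfg : ∀ x S, f (m x S) = g (m x S))
    (z : Z.X) : f z = g z :=
  hf.eq_of_dense h.dense hg (by rintro _ ⟨x, S, rfl⟩; exact hfg x S) z

end MixedMod

theorem map_mem_repIdeal {E : Type u} [NormedAddCommGroup E] [NormedSpace ℂ E] {W : Corr A}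
    {t : W.X → B} {f : E → B} (hf : IsCLMap f) {S : Set E}
    (hS : closure (Submodule.span ℂ S : Set E) = Set.univ) (h : ∀ x ∈ S, f x ∈ repIdeal t)
    (x : E) : f x ∈ repIdeal t :=
  dense_span_induction hS (P := fun x => f x ∈ repIdeal t) (isClosed_repIdeal.preimage hf.cont) h
    (by rw [hf.map_zero]; exact zero_mem _)
    (fun x y hx hy => by rw [hf.map_add]; exact add_mem hx hy)
    (fun c x hx => by rw [hf.map_smul]; exact Submodule.smul_mem _ c hx) x

theorem map_mem_repIdeal_of_hom {C : Type u} [NonUnitalCStarAlgebra C] (f : B →⋆ₙₐ[ℂ] C)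
    {W : Corr A} {t : W.X → B} {b : B} (hb : b ∈ repIdeal t) :
    f b ∈ repIdeal fun x => f (t x) :=
  repIdeal_induction (P := fun b => f b ∈ repIdeal fun x => f (t x))
    (isClosed_repIdeal.preimage f.isStarHom.isCLMap.cont)
    (fun x c => by rw [map_mul]; exact mul_mem_repIdeal x _)
    (by rw [map_zero]; exact zero_mem _)
    (fun x y hx hy => by rw [map_add]; exact add_mem hx hy)
    (fun c x hx => by rw [map_smul]; exact Submodule.smul_mem _ c hx) hb

namespace Generates

variable {n m : ℕ} {G : GenSys A n} {hm : m ≤ n} {Xs' : PSys A m}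
  (gen' : Generates (G.restrict m hm) Xs') (C' : PSCPAlg Xs')

/-- The map `Y_i → 𝒪(Y_1 ∗ ⋯ ∗ Y_m)` for `i ≤ m`. -/
def genMap (i : Fin m) (x : (G.Y (Fin.castLE hm i)).X) : C'.O :=
  C'.rep.ψ (egen i) ((gen'.ι i).toFun x)

theorem isRep_genMap (i : Fin m) :
    IsRep (G.Y (Fin.castLE hm i)) C'.rep.π (gen'.genMap C' i) :=
  gen'.isRep C'.rep i

theorem mem_repIdeal_genMap (i : Fin m) (a : A) : C'.rep.π a ∈ repIdeal (gen'.genMap C' i) :=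
  ((gen'.ι i).repIdeal_comp (t := C'.rep.ψ (egen i))).symm ▸
    (C'.covariant (egen i)).mem_repIdeal (Xs'.reg _).2 a

theorem flipRel_genMap (i j : Fin m) :
    G.FlipRel (Fin.castLE hm i) (Fin.castLE hm j) (gen'.genMap C' i) (gen'.genMap C' j) :=
  gen'.flipRel C'.rep i j

end Generates

namespace EPCorr

variable {n m : ℕ} {G : GenSys A n} {hm : m ≤ n} {Xs' : PSys A m}
  {gen' : Generates (G.restrict m hm) Xs'} {C' : PSCPAlg Xs'} {l : Fin n} {Z : Corr C'.O}
  {mm : (G.Y l).X → C'.O → Z.X}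

theorem exists_lact_genMap (hZ : EPCorr G hm Xs' gen' C' l Z mm) (i : Fin m) :
    ∃ μ : (G.T l (Fin.castLE hm i)).X → C'.O → Z.X, (∀ S, IsCLMap fun u => μ u S) ∧
      (∀ y u S, μ (G.tmul l (Fin.castLE hm i) y u) S = mm y (gen'.genMap C' i u * S)) ∧
      ∀ x y S, Z.lactL (gen'.genMap C' i x) (mm y S) =
        μ ((G.θ (Fin.castLE hm i) l).toFun (G.tmul (Fin.castLE hm i) l x y)) S :=
  hZ.lact_t i

section Induce

variable {Φ : C'.O →⋆ₙₐ[ℂ] B} {tl : (G.Y l).X → B} {t' : Z.X → B}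

theorem map_lact_pi (hZ : EPCorr G hm Xs' gen' C' l Z mm) (ht' : IsCLMap t')
    (htm : ∀ y S, t' (mm y S) = tl y * Φ S)
    (hl : IsRep (G.Y l) (fun a => Φ (C'.rep.π a)) tl) (a : A) (z : Z.X) :
    t' (Z.lactL (C'.rep.π a) z) = Φ (C'.rep.π a) * t' z :=
  hZ.mod.eq_of_eq (ht'.comp (Z.lactL _).isCLMap) ((isCLMap_mul_left _).comp ht')
    (fun y S => by rw [hZ.lact_pi, htm, htm, hl.lact, mul_assoc]) z

theorem map_lact_gen (hZ : EPCorr G hm Xs' gen' C' l Z mm) (ht' : IsCLMap t')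
    (htm : ∀ y S, t' (mm y S) = tl y * Φ S) {i : Fin m}
    (hflip : G.FlipRel (Fin.castLE hm i) l (fun x => Φ (gen'.genMap C' i x)) tl)
    (x : (G.Y (Fin.castLE hm i)).X) (z : Z.X) :
    t' (Z.lactL (gen'.genMap C' i x) z) =
      Φ (gen'.genMap C' i x) * t' z := by
  obtain ⟨M, M', hM, hM', h₁, h₂, h₃⟩ := hflip
  obtain ⟨μ, hμ, hμ₁, hμ₂⟩ := hZ.exists_lact_genMap i
  have key : ∀ u S, t' (μ u S) = M' u * Φ S := fun u S =>
    (G.isTensor _ _).eq_of_eq (ht'.comp (hμ S)) ((isCLMap_mul_right _).comp hM')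
      (fun y x => by rw [hμ₁, htm, h₂, map_mul, mul_assoc]) u
  refine hZ.mod.eq_of_eq (ht'.comp (Z.lactL _).isCLMap) ((isCLMap_mul_left _).comp ht')
    (fun y S => ?_) z
  rw [hμ₂, key, h₃, h₁, htm, mul_assoc]

theorem repIdeal_le (htm : ∀ y S, t' (mm y S) = tl y * Φ S)
    (hl : IsRep (G.Y l) (fun a => Φ (C'.rep.π a)) tl) {b : B}
    (hb : b ∈ repIdeal tl) : b ∈ repIdeal t' := by
  have h : ∀ y, tl y ∈ repIdeal t' := by
    refine map_mem_repIdeal hl.isCLMap (G.Y l).dense_span_ract ?_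
    rintro _ ⟨y, a, rfl⟩
    refine map_mem_repIdeal (f := fun a => tl ((G.Y l).ract y a)) ?_ (dense_span_mul A) ?_ a
    · simp only [hl.ract]
      exact (isCLMap_mul_left _).comp hl.hom.isCLMap
    · rintro _ ⟨a, b, rfl⟩
      rw [hl.ract, C'.rep.isRep 0 |>.hom.map_mul, map_mul, ← mul_assoc, ← htm]
      exact mul_mem_repIdeal _ _
  exact mem_of_mem_repIdeal isClosed_repIdeal IsCLMap.id
    (fun x c => repIdeal_mul_mem (h x) c) hb

/-- The adjoint of a generator maps `t_l(Y_l)` into the right ideal generated by `t_l(Y_l)`. -/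
theorem star_gen_mul_mem (hl : IsRep (G.Y l) (fun a => Φ (C'.rep.π a)) tl)
    {i : Fin m}
    (hflip : G.FlipRel (Fin.castLE hm i) l (fun x => Φ (gen'.genMap C' i x)) tl)
    (x : (G.Y (Fin.castLE hm i)).X) (y : (G.Y l).X) :
    star (Φ (gen'.genMap C' i x)) * tl y ∈ repIdeal tl := by
  have hi := (gen'.isRep_genMap C' i).comp Φ.isStarHom
  have hmem := fun a => map_mem_repIdeal_of_hom Φ (gen'.mem_repIdeal_genMap C' i a)
  set ti := fun x => Φ (gen'.genMap C' i x)
  change star (ti x) * tl y ∈ repIdeal tl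
  obtain ⟨M, M', hM, hM', h₁, h₂, h₃⟩ := hflip
  have hMmem : ∀ w c, star (ti x) * (M w * c) ∈ repIdeal tl := by
    intro w c
    refine map_mem_repIdeal (f := fun w => star (ti x) * (M w * c))
      ((isCLMap_mul_left _).comp ((isCLMap_mul_right c).comp hM)) (G.isTensor _ _).dense ?_ w
    rintro _ ⟨u, v, rfl⟩
    rw [h₁, ← mul_assoc, ← mul_assoc, hi.inner, ← hl.lact]
    exact mul_mem_repIdeal _ _
  refine map_mem_repIdeal (f := fun y => star (ti x) * tl y)
    ((isCLMap_mul_left _).comp hl.isCLMap) (G.Y l).dense_span_ract ?_ y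
  rintro _ ⟨y, a, rfl⟩
  rw [hl.ract]
  refine mem_of_mem_repIdeal isClosed_repIdeal
    (f := fun b => star (ti x) * (tl y * b)) ((isCLMap_mul_left _).comp (isCLMap_mul_left _))
    (fun u c => ?_) (hmem a)
  have h4 : tl y * ti u = M ((G.θ l (Fin.castLE hm i)).toFun (G.tmul _ _ y u)) := by
    rw [← h₃, G.θ_symm, h₂]
  rw [← mul_assoc (tl y), h4]
  exact hMmem _ c

theorem map_lact_star (hZ : EPCorr G hm Xs' gen' C' l Z mm) (ht' : IsCLMap t')
    (htm : ∀ y S, t' (mm y S) = tl y * Φ S)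
    (hl : IsRep (G.Y l) (fun a => Φ (C'.rep.π a)) tl) (hZt : Z.Tame)
    (ht'i : ∀ z w, star (t' z) * t' w = Φ (Z.inner z w)) {S : C'.O}
    (hS : ∀ z, t' (Z.lactL S z) = Φ S * t' z)
    (hmem : ∀ y, star (Φ S) * tl y ∈ repIdeal tl) (z : Z.X) :
    t' (Z.lactL (star S) z) = Φ (star S) * t' z := by
  have hrep : ∀ z c, t' z * c ∈ repIdeal t' := mul_mem_repIdeal
  have hmem' : ∀ z, Φ (star S) * t' z ∈ repIdeal t' := by
    refine map_mem_repIdeal ((isCLMap_mul_left _).comp ht') hZ.mod.dense ?_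
    rintro _ ⟨y, T, rfl⟩
    rw [htm, ← mul_assoc, map_star]
    exact repIdeal_mul_mem (repIdeal_le htm hl (hmem y)) _
  have hmem'' : ∀ z, t' z ∈ repIdeal t' := by
    refine map_mem_repIdeal ht' Z.dense_span_ract ?_
    rintro _ ⟨z, T, rfl⟩
    have : t' (Z.ract z T) = t' z * Φ T :=
      hZ.mod.eq_of_eq (ht'.comp (hZt.ract_left T)) ((isCLMap_mul_right _).comp ht')
        (fun y S => by rw [hZ.mod.ract, htm, htm, map_mul, mul_assoc]) z
    rw [this]
    exact hrep _ _
  set D := t' (Z.lactL (star S) z) - Φ (star S) * t' z with hD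
  have hDmem : D ∈ repIdeal t' := sub_mem (hmem'' _) (hmem' _)
  have hort : ∀ w, star D * t' w = 0 := by
    intro w
    have h1 : star (Φ (star S) * t' z) * t' w = Φ (Z.inner z (Z.lactL S w)) := by
      rw [← ht'i, hS, star_mul, ← map_star, star_star, mul_assoc]
    rw [hD, star_sub, sub_mul, ht'i, h1, Z.lact_adjoint, star_star, sub_self]
  have h0 : star D * D = 0 := by
    refine repIdeal_induction (P := fun b => star D * b = 0)
      (isClosed_eq (isCLMap_mul_left _).cont continuous_const)
      (fun w c => by rw [← mul_assoc, hort, zero_mul]) (mul_zero _)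
      (fun x y hx hy => by rw [mul_add, hx, hy, add_zero])
      (fun c x hx => by rw [mul_smul_comm, hx, smul_zero]) hDmem
  exact sub_eq_zero.1 ((CStarRing.star_mul_self_eq_zero_iff D).1 h0)

end Induce

/-- A covariant representation of `Y_l` compatible with a homomorphism out of the Cuntz–Pimsner
algebra of the remaining correspondences induces a covariant representation of
`Z = Y_l ⊗ 𝒪(Y_1 ∗ ⋯ ∗ Y_m)`. -/
theorem exists_induced_rep (hZ : EPCorr G hm Xs' gen' C' l Z mm) (hZt : Z.Tame)
    (Φ : C'.O →⋆ₙₐ[ℂ] B) {tl : (G.Y l).X → B}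
    (hl : IsRep (G.Y l) (fun a => Φ (C'.rep.π a)) tl)
    (hmem : ∀ a, Φ (C'.rep.π a) ∈ repIdeal tl)
    (hflip : ∀ i, G.FlipRel (Fin.castLE hm i) l
      (fun x => Φ (gen'.genMap C' i x)) tl) :
    ∃ t' : Z.X → B, IsRep Z Φ t' ∧ CPCov Z Φ t' ∧ ∀ y S, t' (mm y S) = tl y * Φ S := by
  obtain ⟨t', ht', htm, hin⟩ := Z.exists_map_of_total hZt Φ.isStarHom
    (fun p : (G.Y l).X × C'.O => mm p.1 p.2) (fun p => tl p.1 * Φ p.2) (by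
      convert hZ.mod.dense using 4
      ext z
      simp [eq_comm]) (fun p q => by
      rw [hZ.mod.inner, star_mul, mul_assoc, ← mul_assoc (star (tl p.1)), hl.inner, map_mul,
        map_mul, map_star])
  replace htm : ∀ y S, t' (mm y S) = tl y * Φ S := fun y S => htm (y, S)
  have hlact : ∀ S, (∀ z, t' (Z.lactL S z) = Φ S * t' z) ∧
      ∀ z, t' (Z.lactL (star S) z) = Φ (star S) * t' z := by
    have hcl : IsClosed {S | ∀ z, t' (Z.lactL S z) = Φ S * t' z} := by
      rw [Set.ofPred_forall]
      exact isClosed_iInter fun z => isClosed_eq (ht'.comp (hZt.lact_left z)).cont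
        ((isCLMap_mul_right _).comp Φ.isStarHom.isCLMap).cont
    have hadd : ∀ p q, (∀ z, t' (Z.lactL p z) = Φ p * t' z) →
        (∀ z, t' (Z.lactL q z) = Φ q * t' z) →
        ∀ z, t' (Z.lactL (p + q) z) = Φ (p + q) * t' z := fun p q hp hq z => by
      rw [Z.lact_add, add_apply, ht'.map_add, hp, hq, map_add, add_mul]
    have hmul : ∀ p q, (∀ z, t' (Z.lactL p z) = Φ p * t' z) →
        (∀ z, t' (Z.lactL q z) = Φ q * t' z) →
        ∀ z, t' (Z.lactL (p * q) z) = Φ (p * q) * t' z := fun p q hp hq z => by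
      rw [Z.lact_mul, ContinuousLinearMap.comp_apply, hp, hq, map_mul, mul_assoc]
    have hsmul : ∀ (c : ℂ) p, (∀ z, t' (Z.lactL p z) = Φ p * t' z) →
        ∀ z, t' (Z.lactL (c • p) z) = Φ (c • p) * t' z := fun c p hp z => by
      rw [Z.lact_smul, smul_apply, ht'.map_smul, hp, map_smul, smul_mul_assoc]
    refine gen'.induction C' ?_ ?_ ?_ ?_ ?_ ?_ ?_
    · exact hcl.inter (hcl.preimage continuous_star)
    · intro a
      refine ⟨hZ.map_lact_pi ht' htm hl a, ?_⟩
      rw [← (C'.rep.isRep 0).hom.map_star]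
      exact hZ.map_lact_pi ht' htm hl _
    · intro i x
      have h := hZ.map_lact_gen ht' htm (hflip i) x
      exact ⟨h, hZ.map_lact_star ht' htm hl hZt hin h
        (star_gen_mul_mem hl (hflip i) x)⟩
    · intro p q hp hq
      rw [star_add]
      exact ⟨hadd p q hp.1 hq.1, hadd _ _ hp.2 hq.2⟩
    · intro p q hp hq
      rw [star_mul]
      exact ⟨hmul p q hp.1 hq.1, hmul _ _ hq.2 hp.2⟩
    · intro c p hp
      rw [star_smul]
      exact ⟨hsmul c p hp.1, hsmul _ _ hp.2⟩
    · intro p hp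
      rw [star_star]
      exact ⟨hp.2, hp.1⟩
  have hrep : IsRep Z Φ t' :=
    ⟨Φ.isStarHom, ht'.map_add, ht'.map_smul, fun S => (hlact S).1, fun z T =>
      hZ.mod.eq_of_eq (ht'.comp (hZt.ract_left T)) ((isCLMap_mul_right _).comp ht')
        (fun y S => by rw [hZ.mod.ract, htm, htm, map_mul, mul_assoc]) z, hin⟩
  refine ⟨t', hrep, hrep.cpCov_of_mem hZt fun S => ?_, htm⟩
  have hπ : ∀ a, Φ (C'.rep.π a) ∈ repIdeal t' := fun a => repIdeal_le htm hl (hmem a)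
  have hcl : IsClosed {S | Φ S ∈ repIdeal t'} :=
    isClosed_repIdeal.preimage Φ.isStarHom.isCLMap.cont
  refine (gen'.induction C' (P := fun S => Φ S ∈ repIdeal t' ∧ Φ (star S) ∈ repIdeal t')
    (hcl.inter (hcl.preimage continuous_star)) ?_ ?_ ?_ ?_ ?_ ?_ S).1
  · intro a
    rw [← (C'.rep.isRep 0).hom.map_star]
    exact ⟨hπ _, hπ _⟩
  · intro i x
    have hi := (gen'.isRep_genMap C' i).comp Φ.isStarHom
    change Φ (gen'.genMap C' i x) ∈ _ ∧ Φ (star (gen'.genMap C' i x)) ∈ _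
    constructor
    · refine map_mem_repIdeal hi.isCLMap (G.reg _).1 ?_ x
      rintro _ ⟨a, x, rfl⟩
      rw [hi.lact]
      exact repIdeal_mul_mem (hπ a) _
    · refine dense_span_induction (G.Y _).dense_span_ract
        (P := fun x => Φ (star (gen'.genMap C' i x)) ∈ repIdeal t') ?_ ?_ ?_ ?_ ?_ x
      · simp only [map_star]
        exact isClosed_repIdeal.preimage (continuous_star.comp hi.isCLMap.cont)
      · rintro _ ⟨x, a, rfl⟩
        rw [(gen'.isRep_genMap C' i).ract, star_mul, map_mul, ← (C'.rep.isRep 0).hom.map_star]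
        exact repIdeal_mul_mem (hπ _) _
      · rw [(gen'.isRep_genMap C' i).isCLMap.map_zero, star_zero, map_zero]
        exact zero_mem _
      · intro x y hx hy
        rw [(gen'.isRep_genMap C' i).t_add, star_add, map_add]
        exact add_mem hx hy
      · intro c x hx
        rw [(gen'.isRep_genMap C' i).t_smul, star_smul, map_smul]
        exact Submodule.smul_mem _ _ hx
  · intro p q hp hq
    rw [star_add, map_add, map_add]
    exact ⟨add_mem hp.1 hq.1, add_mem hp.2 hq.2⟩
  · intro p q hp hq
    rw [star_mul, map_mul, map_mul]
    exact ⟨repIdeal_mul_mem hp.1 _, repIdeal_mul_mem hq.2 _⟩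
  · intro c p hp
    rw [star_smul, map_smul, map_smul]
    exact ⟨Submodule.smul_mem _ _ hp.1, Submodule.smul_mem _ _ hp.2⟩
  · intro p hp
    rw [star_star]
    exact ⟨hp.2, hp.1⟩

/-- A faithful representation of `Z = Y_l ⊗ 𝒪(Y_1 ∗ ⋯ ∗ Y_m)`
restricts to a representation of `Y_l`. -/
theorem exists_restricted_rep (hZ : EPCorr G hm Xs' gen' C' l Z mm) (hY : (G.Y l).Tame)
    {Φ : C'.O →⋆ₙₐ[ℂ] B} (hΦ : Function.Injective Φ) {s : Z.X → B} (hs : IsRep Z Φ s) :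
    ∃ (tl : (G.Y l).X → B) (j : (G.Y l).X → Z.X),
      IsRep (G.Y l) (fun a => Φ (C'.rep.π a)) tl ∧ (∀ y S, s (mm y S) = tl y * Φ S) ∧
        ∀ y, s (j y) = tl y := by
  have hπ := (C'.rep.isRep 0).hom
  obtain ⟨tl, htl, htv, hin⟩ := (G.Y l).exists_map_of_total hY (Φ.isStarHom.comp hπ)
    (fun p : (G.Y l).X × A => (G.Y l).ract p.1 p.2) (fun p => s (mm p.1 (C'.rep.π p.2))) (by
      convert (G.Y l).dense_span_ract using 4
      ext z
      simp [eq_comm]) (fun p q => by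
      rw [hs.inner, hZ.mod.inner, (G.Y l).inner_ract_left, (G.Y l).inner_ract_right, hπ.map_mul,
        hπ.map_mul, hπ.map_star])
  replace htv : ∀ y a, tl ((G.Y l).ract y a) = s (mm y (C'.rep.π a)) := fun y a => htv (y, a)
  have hmul : ∀ y S, s (mm y S) = tl y * Φ S := fun y S => by
    refine IsCLMap.eq_of_dense (G.Y l).dense_span_ract
      (hs.isCLMap.comp (hZ.mod.isCLMap_left hπ S)) ((isCLMap_mul_right _).comp htl) ?_ y
    rintro _ ⟨y, a, rfl⟩
    rw [htv, ← hs.ract, hZ.mod.ract, hZ.mod.balanced]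
  have hrange : IsClosed (Set.range s) := by
    refine (AddMonoidHomClass.isometry_of_norm (AddMonoidHom.mk' s hs.t_add)
      (hs.norm_eq hΦ)).isClosedEmbedding.isClosed_range
  have hj : ∀ y, ∃ z, s z = tl y := by
    refine dense_span_induction (G.Y l).dense_span_ract (P := fun y => ∃ z, s z = tl y)
      (hrange.preimage htl.cont) ?_ ⟨0, by rw [hs.isCLMap.map_zero, htl.map_zero]⟩ ?_ ?_
    · rintro _ ⟨y, a, rfl⟩
      exact ⟨_, (htv y a).symm⟩
    · rintro x y ⟨z, hz⟩ ⟨w, hw⟩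
      exact ⟨z + w, by rw [hs.t_add, htl.map_add, hz, hw]⟩
    · rintro c x ⟨z, hz⟩
      exact ⟨c • z, by rw [hs.t_smul, htl.map_smul, hz]⟩
  choose j hj using hj
  refine ⟨tl, j, ⟨Φ.isStarHom.comp hπ, htl.map_add, htl.map_smul, fun a y => ?_, fun y a => ?_,
    hin⟩, hmul, hj⟩
  · refine IsCLMap.eq_of_dense (G.Y l).dense_span_ract
      (htl.comp ((G.Y l).lactL a).isCLMap) ((isCLMap_mul_left _).comp htl) ?_ y
    rintro _ ⟨y, b, rfl⟩
    rw [Corr.lact_ract, htv, htv, ← hZ.lact_pi, hs.lact]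
  · rw [htv, hmul]

/-- The restriction of a faithful covariant representation of
`Z = Y_l ⊗ 𝒪(Y_1 ∗ ⋯ ∗ Y_m)` is covariant. -/
theorem mem_repIdeal_restricted (hZ : EPCorr G hm Xs' gen' C' l Z mm) (hY : (G.Y l).Tame)
    {Φ : C'.O →⋆ₙₐ[ℂ] B} (hΦ : Function.Injective Φ) {s : Z.X → B} (hs : IsRep Z Φ s)
    (hcov : CPCov Z Φ s) {tl : (G.Y l).X → B} {j : (G.Y l).X → Z.X}
    (hl : IsRep (G.Y l) (fun a => Φ (C'.rep.π a)) tl) (hmul : ∀ y S, s (mm y S) = tl y * Φ S)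
    (hj : ∀ y, s (j y) = tl y) (a : A) : Φ (C'.rep.π a) ∈ repIdeal tl := by
  have hmem : ∀ z, s z ∈ repIdeal tl := by
    refine map_mem_repIdeal hs.isCLMap hZ.mod.dense ?_
    rintro _ ⟨y, S, rfl⟩
    rw [hmul]
    exact mul_mem_repIdeal _ _
  exact (hcov.of_factor hs hΦ hY hl (fun _ => rfl) hj hmem).mem_repIdeal (G.reg l).2 a

theorem flipRel_restricted (hZ : EPCorr G hm Xs' gen' C' l Z mm) (hT : ∀ i j, (G.T i j).Tame)
    {Φ : C'.O →⋆ₙₐ[ℂ] B} {s : Z.X → B} (hs : IsRep Z Φ s) {tl : (G.Y l).X → B}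
    (hl : IsRep (G.Y l) (fun a => Φ (C'.rep.π a)) tl) (hmul : ∀ y S, s (mm y S) = tl y * Φ S)
    (i : Fin m) : G.FlipRel (Fin.castLE hm i) l (fun x => Φ (gen'.genMap C' i x)) tl := by
  have hi := (gen'.isRep_genMap C' i).comp Φ.isStarHom
  obtain ⟨M, hM, hMm⟩ := (G.isTensor (Fin.castLE hm i) l).exists_isRep (hT _ _) hi hl
  obtain ⟨M', hM', hMm'⟩ := (G.isTensor l (Fin.castLE hm i)).exists_isRep (hT _ _) hl hi
  obtain ⟨μ, hμ, hμ₁, hμ₂⟩ := hZ.exists_lact_genMap i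
  have h₁ : ∀ u S, M' u * Φ S = s (μ u S) := fun u S =>
    (G.isTensor l (Fin.castLE hm i)).eq_of_eq ((isCLMap_mul_right _).comp hM'.isCLMap)
      (hs.isCLMap.comp (hμ S)) (fun y x => by rw [hMm', hμ₁, hmul, map_mul, mul_assoc]) u
  have h₂ : ∀ z S, M' ((G.θ (Fin.castLE hm i) l).toFun z) * Φ S = M z * Φ S := fun z S =>
    (G.isTensor (Fin.castLE hm i) l).eq_of_eq
      ((isCLMap_mul_right _).comp (hM'.isCLMap.comp (G.θ _ _).isCLMap))
      ((isCLMap_mul_right _).comp hM.isCLMap)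
      (fun x y => by rw [h₁, ← hμ₂, hs.lact, hmul, hMm, mul_assoc]) z
  refine ⟨M, M', hM.isCLMap, hM'.isCLMap, hMm, hMm', fun z => ?_⟩
  refine IsCLMap.eq_of_dense (G.T _ _).dense_span_ract (hM'.isCLMap.comp (G.θ _ _).isCLMap)
    hM.isCLMap ?_ z
  rintro _ ⟨z, a, rfl⟩
  rw [(G.θ _ _).map_ract, hM'.ract, hM.ract, h₂]

end EPCorr

/-- Dependent functions on `Fin n` glued from values on the range of `Fin.castLE` and on the one
remaining index. -/
theorem Fin.exists_extend_castLE {n m : ℕ} {hm : m ≤ n} {l : Fin n}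
    (hne : ∀ i, Fin.castLE hm i ≠ l) (hcases : ∀ i, i = l ∨ ∃ i', i = Fin.castLE hm i')
    {F : Fin n → Type*} (f : ∀ i, F (Fin.castLE hm i)) (g : F l) :
    ∃ t : ∀ i, F i, (∀ i, t (Fin.castLE hm i) = f i) ∧ t l = g := by
  have (i : Fin n) : ∃ v : F i, (∀ i', Fin.castLE hm i' = i → HEq v (f i')) ∧
      (l = i → HEq v g) := by
    obtain rfl | ⟨i', rfl⟩ := hcases i
    · exact ⟨g, fun i' h => (hne i' h).elim, fun _ => HEq.rfl⟩
    · refine ⟨f i', fun j h => ?_, fun h => (hne i' h.symm).elim⟩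
      obtain rfl := Fin.castLE_injective hm h
      rfl
  choose t h₁ h₂ using this
  exact ⟨t, fun i => eq_of_heq (h₁ _ i rfl), eq_of_heq (h₂ l rfl)⟩

namespace Generates

variable {n : ℕ} {G : GenSys A n} {Xs : PSys A n}

theorem tame (gen : Generates G Xs) (CX : PSCPAlg Xs) (i : Fin n) : (G.Y i).Tame :=
  (gen.isRep CX.rep i).tame CX.inj

theorem tame_tensor (gen : Generates G Xs) (CX : PSCPAlg Xs) (i j : Fin n) : (G.T i j).Tame :=
  ((gen.κ i j).isRep (CX.rep.isRep _)).tame CX.inj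

theorem mem_repIdeal (gen : Generates G Xs) (CX : PSCPAlg Xs) (i : Fin n) (a : A) :
    CX.rep.π a ∈ repIdeal fun x => CX.rep.ψ (egen i) ((gen.ι i).toFun x) :=
  ((gen.ι i).repIdeal_comp (t := CX.rep.ψ (egen i))).symm ▸
    (CX.covariant (egen i)).mem_repIdeal (Xs.reg _).2 a

end Generates

namespace EPCorr

variable {n m : ℕ} {G : GenSys A n} {hm : m ≤ n} {Xs : PSys A n} {Xs' : PSys A m}
  {gen' : Generates (G.restrict m hm) Xs'} {C' : PSCPAlg Xs'}
  {l : Fin n} {Z : Corr C'.O} {mm : (G.Y l).X → C'.O → Z.X}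

/-- The homomorphism `𝒪(Y_l ⊗ 𝒪(Y_1 ∗ ⋯ ∗ Y_m)) → 𝒪(Y_1 ∗ ⋯ ∗ Y_n)`. -/
theorem exists_hom_of_induced (hZ : EPCorr G hm Xs' gen' C' l Z mm)
    (gen : Generates G Xs) (CX : PSCPAlg Xs)
    (CZ : CPAlg Z) :
    ∃ (g : CZ.O →⋆ₙₐ[ℂ] CX.O) (Φ : C'.O →⋆ₙₐ[ℂ] CX.O),
      (∀ a, Φ (C'.rep.π a) = CX.rep.π a) ∧
      (∀ i x, Φ (gen'.genMap C' i x) =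
        CX.rep.ψ (egen (Fin.castLE hm i)) ((gen.ι (Fin.castLE hm i)).toFun x)) ∧
      (∀ S, g (CZ.π S) = Φ S) ∧
      ∀ y S, g (CZ.t (mm y S)) = CX.rep.ψ (egen l) ((gen.ι l).toFun y) * Φ S := by
  obtain ⟨Φ, hΦπ, hΦ⟩ := gen'.exists_hom C' (CX.rep.isRep 0).hom
    (fun i x => CX.rep.ψ (egen (Fin.castLE hm i)) ((gen.ι (Fin.castLE hm i)).toFun x))
    (fun i => gen.isRep CX.rep _) (fun i j _ => gen.flipRel CX.rep _ _)
    (fun i a => gen.mem_repIdeal CX _ a)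
  obtain ⟨t', ht', hcov, htm⟩ := hZ.exists_induced_rep (CZ.isRep.tame CZ.inj) Φ
    (tl := fun y => CX.rep.ψ (egen l) ((gen.ι l).toFun y))
    (by simpa only [hΦπ] using gen.isRep CX.rep l)
    (fun a => by rw [hΦπ]; exact gen.mem_repIdeal CX l a)
    (fun i => by
      have h : (fun x => Φ (gen'.genMap C' i x)) = fun x =>
        CX.rep.ψ (egen (Fin.castLE hm i)) ((gen.ι (Fin.castLE hm i)).toFun x) := funext (hΦ i)
      rw [h]
      exact gen.flipRel CX.rep _ _)
  obtain ⟨g, ⟨hgπ, hgt⟩, -⟩ := CZ.universal CX.O Φ t' ht' hcov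
  exact ⟨g, Φ, hΦπ, hΦ, hgπ, fun y S => by rw [hgt, htm]⟩

/-- The homomorphism `𝒪(Y_1 ∗ ⋯ ∗ Y_n) → 𝒪(Y_l ⊗ 𝒪(Y_1 ∗ ⋯ ∗ Y_m))`. -/
theorem exists_hom_to_induced (hZ : EPCorr G hm Xs' gen' C' l Z mm)
    (gen : Generates G Xs) (CX : PSCPAlg Xs)
    (CZ : CPAlg Z) (hne : ∀ i, Fin.castLE hm i ≠ l)
    (hcases : ∀ i, i = l ∨ ∃ i', i = Fin.castLE hm i') :
    ∃ (h : CX.O →⋆ₙₐ[ℂ] CZ.O),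
      (∀ a, h (CX.rep.π a) = CZ.π (C'.rep.π a)) ∧
      (∀ i x, h (CX.rep.ψ (egen (Fin.castLE hm i)) ((gen.ι (Fin.castLE hm i)).toFun x)) =
        CZ.π (gen'.genMap C' i x)) ∧
      ∀ y S, CZ.t (mm y S) = h (CX.rep.ψ (egen l) ((gen.ι l).toFun y)) * CZ.π S := by
  set Φ := CZ.isRep.hom.toHom
  have hs : IsRep Z Φ CZ.t := CZ.isRep
  have hcov : CPCov Z Φ CZ.t := CZ.covariant
  have hΦ : Function.Injective Φ := CZ.inj
  obtain ⟨tl, j, hl, hmul, hj⟩ := hZ.exists_restricted_rep (gen.tame CX l) hΦ hs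
  obtain ⟨t, ht, htl⟩ := Fin.exists_extend_castLE hne hcases (F := fun i => (G.Y i).X → CZ.O)
    (fun i x => Φ (gen'.genMap C' i x)) tl
  have hflip := hZ.flipRel_restricted (gen.tame_tensor CX) hs hl hmul
  obtain ⟨h, hπ, hψ⟩ := gen.exists_hom CX hl.hom t (fun i => by
      obtain rfl | ⟨i, rfl⟩ := hcases i
      · rwa [htl]
      · rw [ht]
        exact (gen'.isRep_genMap C' i).comp Φ.isStarHom)
    (fun i k hik => by
      obtain rfl | ⟨i, rfl⟩ := hcases i <;> obtain rfl | ⟨k, rfl⟩ := hcases k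
      · exact (hik rfl).elim
      · rw [htl, ht]
        exact (hflip k).symm
      · rw [htl, ht]
        exact hflip i
      · rw [ht, ht]
        exact (gen'.flipRel_genMap C' i k).comp Φ)
    (fun i a => by
      obtain rfl | ⟨i, rfl⟩ := hcases i
      · rw [htl]
        exact hZ.mem_repIdeal_restricted (gen.tame CX _) hΦ hs hcov hl hmul hj a
      · rw [ht]
        exact map_mem_repIdeal_of_hom Φ (gen'.mem_repIdeal_genMap C' i a))
  refine ⟨h, hπ, fun i x => by rw [hψ, ht]; rfl, fun y S => ?_⟩
  rw [hψ, htl]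
  exact hmul y S

/-- The Cuntz–Pimsner algebra of a product system is that of the correspondence obtained by
splitting off one generator. -/
theorem nonempty_starAlgEquiv (hZ : EPCorr G hm Xs' gen' C' l Z mm)
    (gen : Generates G Xs) (CX : PSCPAlg Xs)
    (CZ : CPAlg Z) (hne : ∀ i, Fin.castLE hm i ≠ l)
    (hcases : ∀ i, i = l ∨ ∃ i', i = Fin.castLE hm i') : Nonempty (CX.O ≃⋆ₐ[ℂ] CZ.O) := by
  obtain ⟨g, Φ, hΦπ, hΦ, hgπ, hgt⟩ := hZ.exists_hom_of_induced gen CX CZ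
  obtain ⟨h, hhπ, hhψ, hht⟩ := hZ.exists_hom_to_induced gen CX CZ hne hcases
  have hhΦ (S : C'.O) : h (Φ S) = CZ.π S :=
    gen'.hom_ext C' (f := h.comp Φ) (g := CZ.isRep.hom.toHom)
      (fun a => (congrArg h (hΦπ a)).trans (hhπ a))
      (fun i x => (congrArg h (hΦ i x)).trans (hhψ i x)) S
  have hgh (z : CX.O) : g (h z) = z := by
    refine gen.hom_ext CX (f := g.comp h) (g := NonUnitalStarAlgHom.id ℂ CX.O)
      (fun a => ?_) (fun i => ?_) z
    · change g (h _) = CX.rep.π a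
      rw [hhπ, hgπ, hΦπ]
    · obtain rfl | ⟨i, rfl⟩ := hcases i
      · have hl := gen.isRep CX.rep i
        refine fun y => IsCLMap.eq_of_dense (G.Y i).dense_span_ract
          ((g.comp h).isStarHom.isCLMap.comp hl.isCLMap) hl.isCLMap ?_ y
        rintro _ ⟨y, a, rfl⟩
        change g (h (CX.rep.ψ (egen i) ((gen.ι i).toFun _))) = CX.rep.ψ (egen i) _
        rw [hl.ract, map_mul, hhπ, ← hht, hgt, hΦπ]
      · intro x
        change g (h _) = CX.rep.ψ _ _
        rw [hhψ, hgπ, hΦ]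
  have hhg (z : CZ.O) : h (g z) = z := by
    refine CZ.hom_ext (f := h.comp g) (g := NonUnitalStarAlgHom.id ℂ CZ.O)
      (fun S => (congrArg h (hgπ S)).trans (hhΦ S)) (fun x => ?_) z
    refine hZ.mod.eq_of_eq ((h.comp g).isStarHom.isCLMap.comp CZ.isRep.isCLMap)
      CZ.isRep.isCLMap (fun y S => ?_) x
    change h (g _) = _
    rw [hgt, map_mul, hhΦ, hht]
  exact ⟨StarAlgEquiv.ofBijective h ⟨Function.LeftInverse.injective hgh,
    Function.RightInverse.surjective hhg⟩⟩

end EPCorr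

/-- Corollary `maincor`.  If `(Y, θ)` is a generating
system of `n` nondegenerate regular `A`-correspondences, then
`𝒪(Y₁ ∗ ⋯ ∗ Y_n) ≅ 𝒪(Y_n ⊗_A 𝒪(Y₁ ∗ ⋯ ∗ Y_{n-1}))`, where
`Y_n ⊗_A 𝒪(Y₁ ∗ ⋯ ∗ Y_{n-1})` carries the correspondence structure whose
left action is determined by the flips `θ_{i n}` via the absorption maps. -/
theorem CP_product_system_iso_CP_of_last_induced
    {A : Type u} [NonUnitalCStarAlgebra A]
    {n : ℕ} (G : GenSys A n) (hn : 0 < n)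
    (Xs : PSys A n) (gen : Generates G Xs) (CX : PSCPAlg Xs)
    (Xs' : PSys A (n - 1))
    (gen' : Generates (G.restrict (n - 1) (Nat.sub_le n 1)) Xs')
    (C' : PSCPAlg Xs')
    (Z : Corr C'.O)
    (mm : (G.Y ⟨n - 1, by omega⟩).X → C'.O → Z.X)
    (hZ : EPCorr G (Nat.sub_le n 1) Xs' gen' C' ⟨n - 1, by omega⟩ Z mm)
    (CZ : CPAlg Z) :
    Nonempty (CX.O ≃⋆ₐ[ℂ] CZ.O) := by
  refine hZ.nonempty_starAlgEquiv gen CX CZ (fun i h => ?_) fun i => ?_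
  · have := congrArg Fin.val h
    simp only [Fin.val_castLE] at this
    omega
  · by_cases h : i.val = n - 1
    · exact Or.inl (Fin.ext h)
    · exact Or.inr ⟨⟨i.val, by omega⟩, rfl⟩
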